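/- arXiv:1807.07372 — 2 statements merged into one kernel-verified Lean document; each statement's English description precedes it below -/
import Mathlib

section
/- Let G be a chordal contact B₀-VPG finite simple graph and let v be a vertex of G that is not internal. Then there exists a contact B₀-VPG representation of G in which P_v is a horizontal segment whose right endpoint (a, b) is free, and every point of every segment P_w with w ≠ v has first coordinate strictly smaller than a. -/
open SimpleGraph

/-- A horizontal grid segment on row `y`, spanning columns `a` to `b`. -/
def IsHorizSeg (S : Set (ℤ × ℤ)) : Prop :=
  ∃ y a b : ℤ, a ≤ b ∧ S = {p : ℤ × ℤ | p.2 = y ∧ a ≤ p.1 ∧ p.1 ≤ b}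

/-- A vertical grid segment on column `x`, spanning rows `a` to `b`. -/
def IsVertSeg (S : Set (ℤ × ℤ)) : Prop :=
  ∃ x a b : ℤ, a ≤ b ∧ S = {p : ℤ × ℤ | p.1 = x ∧ a ≤ p.2 ∧ p.2 ≤ b}

/-- A grid segment is a horizontal or vertical segment. -/
def IsGridSegment (S : Set (ℤ × ℤ)) : Prop := IsHorizSeg S ∨ IsVertSeg S

/-- `p` is an endpoint (extreme point) of the grid segment `S`. -/
def IsEndpointOf (p : ℤ × ℤ) (S : Set (ℤ × ℤ)) : Prop :=
  (∃ y a b : ℤ, a ≤ b ∧ S = {q : ℤ × ℤ | q.2 = y ∧ a ≤ q.1 ∧ q.1 ≤ b} ∧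
      (p = (a, y) ∨ p = (b, y))) ∨
  (∃ x a b : ℤ, a ≤ b ∧ S = {q : ℤ × ℤ | q.1 = x ∧ a ≤ q.2 ∧ q.2 ≤ b} ∧
      (p = (x, a) ∨ p = (x, b)))

/-- A contact B₀-VPG representation of a simple graph `G`. -/
structure ContactB0VPGRep {V : Type*} (G : SimpleGraph V) where
  seg : V → Set (ℤ × ℤ)
  isSeg : ∀ v : V, IsGridSegment (seg v)
  adj_iff : ∀ u v : V, u ≠ v → (G.Adj u v ↔ (seg u ∩ seg v).Nonempty)
  inter_subsingleton : ∀ u v : V, u ≠ v → (seg u ∩ seg v).Subsingleton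
  contact : ∀ u v : V, u ≠ v → ∀ p ∈ seg u ∩ seg v,
    IsEndpointOf p (seg u) ∨ IsEndpointOf p (seg v)

/-- A graph is contact B₀-VPG if it admits a contact B₀-VPG representation. -/
def ContactB0VPG {V : Type*} (G : SimpleGraph V) : Prop :=
  Nonempty (ContactB0VPGRep G)

/-- `G` is `H`-free: no induced subgraph of `G` is isomorphic to `H`. -/
def Free {V : Type*} {W : Type*} (G : SimpleGraph V) (H : SimpleGraph W) : Prop :=
  IsEmpty (H ↪g G)

/-- The complete graph `K₅`. -/
def K5 : SimpleGraph (Fin 5) := ⊤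

/-- The complete bipartite graph `K₃,₃`. -/
def K33 : SimpleGraph (Fin 3 ⊕ Fin 3) := completeBipartiteGraph (Fin 3) (Fin 3)

/-- The graph `K₄ − e`. -/
def K4e : SimpleGraph (Fin 4) := (⊤ : SimpleGraph (Fin 4)).deleteEdges {s(0, 1)}

/-- The graph `H₀`: three copies of `K₄` sharing exactly the common vertex `0`. -/
def H0 : SimpleGraph (Fin 10) :=
  SimpleGraph.fromRel (fun a b => a = 0 ∨ b = 0 ∨ (a.val - 1) / 3 = (b.val - 1) / 3)

/-- A graph is chordal if it has no induced cycle of length at least 4. -/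
def Chordal {V : Type*} (G : SimpleGraph V) : Prop :=
  ∀ n : ℕ, 4 ≤ n → IsEmpty (cycleGraph n ↪g G)

/-- In the representation `R`, `p` is a free endpoint of the segment of `v`. -/
def RepFreeEndpoint {V : Type*} {G : SimpleGraph V} (R : ContactB0VPGRep G)
    (v : V) (p : ℤ × ℤ) : Prop :=
  IsEndpointOf p (R.seg v) ∧ ∀ w : V, w ≠ v → p ∉ R.seg w

/-- `v` is internal: no contact B₀-VPG representation of `G` has a free endpoint of `P_v`. -/
def InternalVertex {V : Type*} (G : SimpleGraph V) (v : V) : Prop :=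
  ∀ R : ContactB0VPGRep G, ¬ ∃ p : ℤ × ℤ, RepFreeEndpoint R v p

/-- The graph `G_T` built from a base tree `T`: each vertex `v` of `T` gets `3 - deg v`
new pendant copies of `K₄` through `v`. -/
def GraphGT {V : Type*} [Fintype V] (T : SimpleGraph V) [DecidableRel T.Adj] :
    SimpleGraph (V ⊕ Σ v : V, Fin (3 - T.degree v) × Fin 3) :=
  SimpleGraph.fromRel (fun a b =>
    match a, b with
    | Sum.inl u, Sum.inl w => T.Adj u w
    | Sum.inl u, Sum.inr x => u = x.1
    | Sum.inr x, Sum.inl w => x.1 = w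
    | Sum.inr x, Sum.inr y => x.1 = y.1 ∧ (x.2.1 : ℕ) = (y.2.1 : ℕ))

/-- A witness that `G` is (isomorphic to) a graph `G_T` for a base tree `T`
with at least two vertices and maximum degree at most `d`. -/
structure BaseTreeWitness {W : Type*} (G : SimpleGraph W) (d : ℕ) where
  V : Type
  [instFin : Fintype V]
  T : SimpleGraph V
  [instDec : DecidableRel T.Adj]
  conn : T.Connected
  acyc : T.IsAcyclic
  two_le : 2 ≤ Fintype.card V
  maxdeg : ∀ v : V, T.degree v ≤ d
  iso : Nonempty (G ≃g GraphGT T)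

/-- Membership in the family `𝒯`. -/
def InFamilyT {W : Type*} (G : SimpleGraph W) : Prop :=
  Nonempty (G ≃g H0) ∨ Nonempty (BaseTreeWitness G 3)

/-- Membership in the family `𝒯'` (base trees of maximum degree at most 2, plus `H₀`). -/
def InFamilyT' {W : Type*} (G : SimpleGraph W) : Prop :=
  Nonempty (G ≃g H0) ∨ Nonempty (BaseTreeWitness G 2)

/-- Integer boxes. -/
structure Bx where
  x1 : ℤ
  x2 : ℤ
  y1 : ℤ
  y2 : ℤ

def Bx.mem (A : Bx) (s t : ℤ) : Prop := A.x1 ≤ s ∧ s ≤ A.x2 ∧ A.y1 ≤ t ∧ t ≤ A.y2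
def Bx.ok (A : Bx) : Prop := A.x1 ≤ A.x2 ∧ A.y1 ≤ A.y2 ∧ (A.x1 = A.x2 ∨ A.y1 = A.y2)
def Bx.cor (A : Bx) (s t : ℤ) : Prop := (s = A.x1 ∨ s = A.x2) ∧ (t = A.y1 ∨ t = A.y2)

structure Good (A B : Bx) (P : Prop) : Prop where
  iff : P ↔ ∃ s t, A.mem s t ∧ B.mem s t
  sub : ∀ s t s' t', A.mem s t → B.mem s t → A.mem s' t' → B.mem s' t' → s = s' ∧ t = t'
  cor : ∀ s t, A.mem s t → B.mem s t → A.cor s t ∨ B.cor s t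

theorem Good.symm {A B : Bx} {P Q : Prop} (h : Good A B P) (hPQ : P ↔ Q) : Good B A Q where
  iff := by
    rw [← hPQ, h.iff]
    constructor
    · rintro ⟨s, t, h1, h2⟩; exact ⟨s, t, h2, h1⟩
    · rintro ⟨s, t, h1, h2⟩; exact ⟨s, t, h2, h1⟩
  sub := fun s t s' t' h1 h2 h3 h4 => h.sub s t s' t' h2 h1 h4 h3
  cor := fun s t h1 h2 => (h.cor s t h2 h1).symm

theorem Good.of_disj {A B : Bx} {P : Prop} (hP : ¬ P)
    (h : ∀ s t, A.mem s t → B.mem s t → False) : Good A B P where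
  iff := ⟨fun p => (hP p).elim, fun ⟨s, t, h1, h2⟩ => (h s t h1 h2).elim⟩
  sub := fun s t _ _ h1 h2 => (h s t h1 h2).elim
  cor := fun s t h1 h2 => (h s t h1 h2).elim

theorem Good.of_pt {A B : Bx} {P : Prop} (hP : P) (a b : ℤ) (hA : A.mem a b) (hB : B.mem a b)
    (h : ∀ s t, A.mem s t → B.mem s t → s = a ∧ t = b)
    (hc : A.cor a b ∨ B.cor a b) : Good A B P where
  iff := ⟨fun _ => ⟨a, b, hA, hB⟩, fun _ => hP⟩
  sub := fun s t s' t' h1 h2 h3 h4 => by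
    have := h s t h1 h2
    have := h s' t' h3 h4
    omega
  cor := fun s t h1 h2 => by
    obtain ⟨rfl, rfl⟩ := h s t h1 h2
    exact hc

theorem Good.replace {A A' B : Bx} {P Q : Prop} (h : Good A B P) (hPQ : P ↔ Q)
    (h1 : ∀ s t, B.mem s t → (A'.mem s t ↔ A.mem s t))
    (h2 : ∀ s t, B.mem s t → A.cor s t → A'.cor s t) : Good A' B Q where
  iff := by
    rw [← hPQ, h.iff]
    constructor
    · rintro ⟨s, t, a, b⟩; exact ⟨s, t, (h1 s t b).2 a, b⟩
    · rintro ⟨s, t, a, b⟩; exact ⟨s, t, (h1 s t b).1 a, b⟩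
  sub := fun s t s' t' a b c d => h.sub s t s' t' ((h1 _ _ b).1 a) b ((h1 _ _ d).1 c) d
  cor := fun s t a b => (h.cor s t ((h1 _ _ b).1 a) b).imp (h2 s t b) id

theorem Good.transfer {A B A' B' : Bx} {P : Prop} (h : Good A B P) (u v u' v' : ℤ → ℤ → ℤ)
    (hs : ∀ s t, u (u' s t) (v' s t) = s ∧ v (u' s t) (v' s t) = t)
    (hi : ∀ s t s' t', u s t = u s' t' → v s t = v s' t' → s = s' ∧ t = t')
    (hA : ∀ s t, A'.mem s t ↔ A.mem (u s t) (v s t))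
    (hB : ∀ s t, B'.mem s t ↔ B.mem (u s t) (v s t))
    (cA : ∀ s t, A.cor (u s t) (v s t) → A'.cor s t)
    (cB : ∀ s t, B.cor (u s t) (v s t) → B'.cor s t) : Good A' B' P where
  iff := by
    rw [h.iff]
    constructor
    · rintro ⟨s, t, a, b⟩
      refine ⟨u' s t, v' s t, ?_, ?_⟩
      · rw [hA, (hs s t).1, (hs s t).2]; exact a
      · rw [hB, (hs s t).1, (hs s t).2]; exact b
    · rintro ⟨s, t, a, b⟩; exact ⟨_, _, (hA _ _).1 a, (hB _ _).1 b⟩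
  sub := fun s t s' t' a b c d => by
    have := h.sub _ _ _ _ ((hA _ _).1 a) ((hB _ _).1 b) ((hA _ _).1 c) ((hB _ _).1 d)
    exact hi _ _ _ _ this.1 this.2
  cor := fun s t a b => (h.cor _ _ ((hA _ _).1 a) ((hB _ _).1 b)).imp (cA s t) (cB s t)

def Bx.shift (k : ℤ) (A : Bx) : Bx := ⟨A.x1 + k, A.x2 + k, A.y1, A.y2⟩
def Bx.up (k : ℤ) (A : Bx) : Bx := ⟨k - A.y2, k - A.y1, A.x1, A.x2⟩
def Bx.dn (k : ℤ) (A : Bx) : Bx := ⟨k + A.y1, k + A.y2, -A.x2, -A.x1⟩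
def Bx.refl (A : Bx) : Bx := ⟨-A.x2, -A.x1, A.y1, A.y2⟩

theorem Good.shift {A B : Bx} {P : Prop} (h : Good A B P) (k : ℤ) :
    Good (A.shift k) (B.shift k) P := by
  refine h.transfer (fun s _ => s - k) (fun _ t => t) (fun s _ => s + k) (fun _ t => t)
    ?_ ?_ ?_ ?_ ?_ ?_ <;> intros <;>
    first | omega | (simp only [Bx.mem, Bx.cor, Bx.shift] at *; omega)

theorem Good.up {A B : Bx} {P : Prop} (h : Good A B P) (k : ℤ) :
    Good (A.up k) (B.up k) P := by
  refine h.transfer (fun _ t => t) (fun s _ => k - s) (fun _ t => k - t) (fun s _ => s)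
    ?_ ?_ ?_ ?_ ?_ ?_ <;> intros <;>
    first | omega | (simp only [Bx.mem, Bx.cor, Bx.up] at *; omega)

theorem Good.dn {A B : Bx} {P : Prop} (h : Good A B P) (k : ℤ) :
    Good (A.dn k) (B.dn k) P := by
  refine h.transfer (fun _ t => -t) (fun s _ => s - k) (fun _ t => k + t) (fun s _ => -s)
    ?_ ?_ ?_ ?_ ?_ ?_ <;> intros <;>
    first | omega | (simp only [Bx.mem, Bx.cor, Bx.dn] at *; omega)

theorem Good.refl {A B : Bx} {P : Prop} (h : Good A B P) :
    Good (A.refl) (B.refl) P := by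
  refine h.transfer (fun s _ => -s) (fun _ t => t) (fun s _ => -s) (fun _ t => t)
    ?_ ?_ ?_ ?_ ?_ ?_ <;> intros <;>
    first | omega | (simp only [Bx.mem, Bx.cor, Bx.refl] at *; omega)

def ArmSpec {V : Type*} (G : SimpleGraph V) (T : Finset V) (N : V → Prop) : Prop :=
  ∃ (f : V → Bx) (len : ℤ), 0 ≤ len ∧ (∀ x ∈ T, (f x).ok ∧ 1 ≤ (f x).x1) ∧
    (∀ x ∈ T, ∀ y ∈ T, x ≠ y → Good (f x) (f y) (G.Adj x y)) ∧
    ∀ x ∈ T, Good ⟨0, len, 0, 0⟩ (f x) (N x)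

theorem ArmSpec.congr {V : Type*} {G : SimpleGraph V} {T : Finset V} {N N' : V → Prop}
    (h : ArmSpec G T N) (hN : ∀ x ∈ T, N x ↔ N' x) : ArmSpec G T N' := by
  obtain ⟨f, len, h0, h1, h2, h3⟩ := h
  exact ⟨f, len, h0, h1, h2, fun x hx =>
    (h3 x hx).replace (hN x hx) (fun _ _ _ => Iff.rfl) (fun _ _ _ h => h)⟩

theorem ArmSpec.trivial {V : Type*} {G : SimpleGraph V} (g : V → Bx) (hok : ∀ x, (g x).ok)
    (hg : ∀ x y, x ≠ y → Good (g x) (g y) (G.Adj x y)) (T : Finset V) (N : V → Prop)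
    (hN : ∀ x ∈ T, ¬ N x) : ArmSpec G T N := by
  obtain ⟨B, hB⟩ : ∃ B : ℤ, ∀ x ∈ T, -(g x).x1 ≤ B := by
    obtain ⟨B, hB⟩ := (T.image fun x => -(g x).x1).bddAbove
    exact ⟨B, fun x hx => hB (by simpa using ⟨x, hx, rfl⟩)⟩
  refine ⟨fun x => (g x).shift (B + 1), 0, le_rfl, ?_, fun x _ y _ h => (hg x y h).shift _, ?_⟩
  · intro x hx
    have := hB x hx
    have := hok x
    simp only [Bx.ok, Bx.shift] at *
    omega
  · intro x hx
    have := hB x hx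
    apply Good.of_disj (hN x hx)
    simp only [Bx.mem, Bx.shift]
    intros
    omega

def armBx (Q B : ℤ) (l : Fin 3 → ℤ) (i : Fin 3) : Bx :=
  if i = 0 then ⟨Q, Q + (B + l 0), 0, 0⟩ else if i = 1 then ⟨Q, Q, 0, l 1⟩ else ⟨Q, Q, -l 2, 0⟩

def regBx (Q B : ℤ) (i : Fin 3) (A : Bx) : Prop :=
  if i = 0 then Q + B + 1 ≤ A.x1 else
  if i = 1 then 1 ≤ A.y1 ∧ Q - B ≤ A.x1 ∧ A.x2 ≤ Q + B
  else A.y2 ≤ -1 ∧ Q - B ≤ A.x1 ∧ A.x2 ≤ Q + B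

theorem place {V : Type*} {G : SimpleGraph V} (T : Fin 3 → Finset V) (N : Fin 3 → V → Prop)
    (h : ∀ i, ArmSpec G (T i) (N i)) :
    ∃ (B : ℤ) (l : Fin 3 → ℤ) (f : Fin 3 → V → Bx), 0 ≤ B ∧ (∀ i, 0 ≤ l i) ∧
      ∀ i, (∀ x ∈ T i, (f i x).ok ∧ regBx (B + 1) B i (f i x)) ∧
      (∀ x ∈ T i, ∀ y ∈ T i, x ≠ y → Good (f i x) (f i y) (G.Adj x y)) ∧
      ∀ x ∈ T i, Good (armBx (B + 1) B l i) (f i x) (N i x) := by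
  choose g l hl h1 h2 h3 using h
  have : ∀ i, ∃ B : ℤ, ∀ x ∈ T i, -(g i x).y1 ≤ B ∧ (g i x).y2 ≤ B := by
    intro i
    obtain ⟨B, hB⟩ := ((T i).image fun x => max (-(g i x).y1) (g i x).y2).bddAbove
    refine ⟨B, fun x hx => ?_⟩
    have : max (-(g i x).y1) (g i x).y2 ≤ B := hB (by simpa using ⟨x, hx, rfl⟩)
    omega
  choose b hb using this
  obtain ⟨B, hB0, hB⟩ : ∃ B : ℤ, 0 ≤ B ∧ ∀ i, b i ≤ B :=
    ⟨|b 0| + |b 1| + |b 2|, by positivity, by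
      have h0 := le_abs_self (b 0)
      have h1 := le_abs_self (b 1)
      have h2 := le_abs_self (b 2)
      have h0' := abs_nonneg (b 0)
      have h1' := abs_nonneg (b 1)
      have h2' := abs_nonneg (b 2)
      intro i
      fin_cases i <;> simp <;> linarith⟩
  refine ⟨B, l, fun i x => if i = 0 then (g i x).shift (B + 1 + B) else
    if i = 1 then (g i x).up (B + 1) else (g i x).dn (B + 1), hB0, hl, ?_⟩
  have key : ∀ i, ∀ x ∈ T i, (g i x).ok ∧ 1 ≤ (g i x).x1 ∧ -(g i x).y1 ≤ B ∧ (g i x).y2 ≤ B :=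
    fun i x hx => ⟨(h1 i x hx).1, (h1 i x hx).2, (hb i x hx).1.trans (hB i),
      (hb i x hx).2.trans (hB i)⟩
  intro i
  have hli := hl i
  fin_cases i
  · refine ⟨fun x hx => ?_, fun x hx y hy hxy => (h2 0 x hx y hy hxy).shift _, fun x hx => ?_⟩
    · have := key 0 x hx
      simp [Bx.ok, regBx, Bx.shift] at *
      omega
    · have := key 0 x hx
      refine ((h3 0 x hx).shift (B + 1 + B)).replace Iff.rfl ?_ ?_ <;>
        simp [armBx, Bx.mem, Bx.cor, Bx.shift] at * <;> intros <;> omega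
  · refine ⟨fun x hx => ?_, fun x hx y hy hxy => (h2 1 x hx y hy hxy).up _, fun x hx => ?_⟩
    · have := key 1 x hx
      simp [Bx.ok, regBx, Bx.up] at *
      omega
    · have := key 1 x hx
      refine ((h3 1 x hx).up (B + 1)).replace Iff.rfl ?_ ?_ <;>
        simp [armBx, Bx.mem, Bx.cor, Bx.up] at * <;> intros <;> omega
  · refine ⟨fun x hx => ?_, fun x hx y hy hxy => (h2 2 x hx y hy hxy).dn _, fun x hx => ?_⟩
    · have := key 2 x hx
      simp [Bx.ok, regBx, Bx.dn] at *
      omega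
    · have := key 2 x hx
      refine ((h3 2 x hx).dn (B + 1)).replace Iff.rfl ?_ ?_ <;>
        simp [armBx, Bx.mem, Bx.cor, Bx.dn] at * <;> intros <;> omega

theorem pt_good {P : Prop} (hP : P) (q m α β γ α' β' γ' : ℤ) (hm : m ≤ q)
    (hα : 0 ≤ α) (hβ : 0 ≤ β) (hγ : 0 ≤ γ) (hα' : 0 ≤ α') (hβ' : 0 ≤ β') (hγ' : 0 ≤ γ')
    (h0 : α = 0 ∨ α' = 0) (h1 : β = 0 ∨ β' = 0) (h2 : γ = 0 ∨ γ' = 0)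
    (c : α = 0 ∨ (β = 0 ∧ γ = 0)) (c' : α' = 0 ∨ (β' = 0 ∧ γ' = 0))
    (hmm : m = q ∨ (β = 0 ∧ γ = 0 ∧ (α = 0 ∨ β' = 0 ∨ γ' = 0))) :
    Good ⟨m, q + α, -γ, β⟩ ⟨q, q + α', -γ', β'⟩ P := by
  refine Good.of_pt hP q 0 ?_ ?_ ?_ ?_ <;> simp only [Bx.mem, Bx.cor] <;> intros <;>
    first | omega | (simp only [true_or, true_and]; omega)

theorem arm_own {B : ℤ} {l : Fin 3 → ℤ} {i : Fin 3} {X : Bx} {P R : Prop}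
    (h : Good (armBx (B + 1) B l i) X P) (hPR : P ↔ R) (hr : regBx (B + 1) B i X)
    (m α β γ : ℤ) (hm : m ≤ B + 1) (hα : 0 ≤ α) (hβ : 0 ≤ β) (hγ : 0 ≤ γ) (hl : ∀ i, 0 ≤ l i)
    (hB : 0 ≤ B)
    (h0 : i = 0 → α = B + l 0 ∧ β = 0 ∧ γ = 0) (h1 : i = 1 → m = B + 1 ∧ α = 0 ∧ β = l 1)
    (h2 : i = 2 → m = B + 1 ∧ α = 0 ∧ γ = l 2) : Good ⟨m, B + 1 + α, -γ, β⟩ X R := by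
  have hl0 := hl 0
  have hl1 := hl 1
  have hl2 := hl 2
  have hfin3 : ∀ i : Fin 3, i = 0 ∨ i = 1 ∨ i = 2 := by decide
  rcases hfin3 i with rfl | rfl | rfl
  · obtain ⟨rfl, rfl, rfl⟩ := h0 rfl
    simp only [regBx, if_true] at hr
    refine h.replace hPR ?_ ?_ <;> simp [armBx, Bx.mem, Bx.cor] <;> intros <;> omega
  · obtain ⟨rfl, rfl, rfl⟩ := h1 rfl
    simp [regBx] at hr
    refine h.replace hPR ?_ ?_ <;> simp [armBx, Bx.mem, Bx.cor] <;> intros <;> omega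
  · obtain ⟨rfl, rfl, rfl⟩ := h2 rfl
    simp [regBx] at hr
    refine h.replace hPR ?_ ?_ <;> simp [armBx, Bx.mem, Bx.cor] <;> intros <;> omega

theorem arm_not {B : ℤ} {i : Fin 3} {X : Bx} {R : Prop}
    (hR : ¬ R) (hr : regBx (B + 1) B i X)
    (m α β γ : ℤ) (hβ : 0 ≤ β) (hγ : 0 ≤ γ) (hB : 0 ≤ B)
    (h0 : i = 0 → α = 0) (h1 : i = 1 → β = 0)
    (h2 : i = 2 → γ = 0) : Good ⟨m, B + 1 + α, -γ, β⟩ X R := by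
  have hfin3 : ∀ i : Fin 3, i = 0 ∨ i = 1 ∨ i = 2 := by decide
  refine Good.of_disj hR ?_
  rcases hfin3 i with rfl | rfl | rfl
  · have := h0 rfl
    simp [regBx, Bx.mem] at *
    intros; omega
  · have := h1 rfl
    simp [regBx, Bx.mem] at *
    intros; omega
  · have := h2 rfl
    simp [regBx, Bx.mem] at *
    intros; omega

open Classical in
theorem glue {V : Type*} {G : SimpleGraph V} (T C : Finset V) (v : V) (hv : v ∉ T) (hCT : C ⊆ T)
    (lab : V → Fin 3) (own : V → Fin 3 → Prop) (N : Fin 3 → V → Prop)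
    (hCC : ∀ x ∈ C, ∀ y ∈ C, x ≠ y → G.Adj x y) (hvC : ∀ x ∈ C, G.Adj v x)
    (hlab : ∀ x ∈ T \ C, ∀ y ∈ T \ C, lab x ≠ lab y → ¬ G.Adj x y)
    (hadj : ∀ x ∈ T \ C, ∀ w, (w ∈ C ∨ w = v) → (G.Adj w x ↔ own w (lab x) ∧ N (lab x) x))
    (harm : ∀ i, ArmSpec G ((T \ C).filter fun x => lab x = i) (N i))
    (huniq : ∀ w, (w ∈ C ∨ w = v) → ∀ w', (w' ∈ C ∨ w' = v) → w ≠ w' → ∀ i,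
      own w i → own w' i → False)
    (hC0 : ∀ x ∈ C, own x 0 → ¬ own x 1 ∧ ¬ own x 2)
    (hv12 : ¬ own v 1 ∧ ¬ own v 2)
    (hcross : ∀ x ∈ C, own v 0 → own x 1 → own x 2 → False) :
    ArmSpec G T (fun x => G.Adj v x) := by
  obtain ⟨B, l, f, hB, hl, hf⟩ := place _ N harm
  have hl0 := hl 0
  have hl1 := hl 1
  have hl2 := hl 2
  set bC : V → Bx := fun x => ⟨B + 1, B + 1 + (if own x 0 then B + l 0 else 0),
    -(if own x 2 then l 2 else 0), if own x 1 then l 1 else 0⟩ with hbC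
  set F : V → Bx := fun x => if x ∈ C then bC x else f (lab x) x with hF
  have hFC : ∀ x ∈ C, F x = bC x := fun x hx => by simp [hF, hx]
  have hFT : ∀ x ∈ T \ C, F x = f (lab x) x := fun x hx => by
    simp only [Finset.mem_sdiff] at hx; simp [hF, hx.2]
  have hfok : ∀ x ∈ T \ C, (F x).ok ∧ regBx (B + 1) B (lab x) (F x) := fun x hx => by
    rw [hFT x hx]; exact (hf (lab x)).1 x (by simpa using hx)
  have hfN : ∀ x ∈ T \ C, Good (armBx (B + 1) B l (lab x)) (F x) (N (lab x) x) := fun x hx => by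
    rw [hFT x hx]; exact (hf (lab x)).2.2 x (by simpa using hx)
  have hCok : ∀ x ∈ C, (F x).ok ∧ 1 ≤ (F x).x1 := fun x hx => by
    rw [hFC x hx]
    have := hC0 x hx
    simp only [hbC, Bx.ok]
    split_ifs <;> first | omega | (exfalso; tauto)
  have hfin3 : ∀ i : Fin 3, i = 0 ∨ i = 1 ∨ i = 2 := by decide
  have hCT' : ∀ w ∈ C, ∀ x ∈ T \ C, Good (F w) (F x) (G.Adj w x) := fun w hw x hx => by
    obtain ⟨h1, h2⟩ := hfok x hx
    have h3 := hfN x hx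
    have h4 := hadj x hx w (Or.inl hw)
    have h5 := hC0 w hw
    rw [hFC w hw]
    by_cases ho : own w (lab x)
    · apply arm_own h3 (by rw [h4]; tauto) h2 _ _ _ _ le_rfl _ _ _ hl hB
      · intro h; rw [h] at ho; simp [ho, h5 ho]
      · intro h; rw [h] at ho
        have : ¬ own w 0 := by tauto
        simp [ho, this]
      · intro h; rw [h] at ho
        have : ¬ own w 0 := by tauto
        simp [ho, this]
      all_goals split_ifs <;> omega
    · apply arm_not (by rw [h4]; tauto) h2 _ _ _ _ _ _ hB
      · intro h; rw [h] at ho; simp [ho]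
      · intro h; rw [h] at ho; simp [ho]
      · intro h; rw [h] at ho; simp [ho]
      all_goals split_ifs <;> omega
  have hor : ∀ (p r : Prop) (a b : ℤ), (p → r → False) →
      (if p then a else 0) = 0 ∨ (if r then b else 0) = 0 := by
    intro p r a b h
    by_cases hp : p
    · right; rw [if_neg (h hp)]
    · left; rw [if_neg hp]
  refine ⟨F, B + 1 + (if own v 0 then B + l 0 else 0), ?_, ?_, ?_, ?_⟩
  · split_ifs <;> omega
  · intro x hx
    by_cases hxC : x ∈ C
    · exact hCok x hxC
    · obtain ⟨h1, h2⟩ := hfok x (by simp [hx, hxC])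
      refine ⟨h1, ?_⟩
      unfold regBx at h2
      split_ifs at h2 <;> omega
  · intro x hx y hy hxy
    by_cases hxC : x ∈ C
    · by_cases hyC : y ∈ C
      · have u := huniq x (Or.inl hxC) y (Or.inl hyC) hxy
        have u0 := u 0
        have u1 := u 1
        have u2 := u 2
        have c1 := hC0 x hxC
        have c2 := hC0 y hyC
        rw [hFC x hxC, hFC y hyC]
        apply pt_good (hCC x hxC y hyC hxy)
        · exact le_rfl
        iterate 6 (split_ifs <;> omega)
        · exact hor _ _ _ _ u0
        · exact hor _ _ _ _ u1
        · exact hor _ _ _ _ u2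
        · by_cases h : own x 0
          · right; simp [c1 h]
          · left; simp [h]
        · by_cases h : own y 0
          · right; simp [c2 h]
          · left; simp [h]
        · left; rfl
      · exact hCT' x hxC y (by simp [hy, hyC])
    · by_cases hyC : y ∈ C
      · exact (hCT' y hyC x (by simp [hx, hxC])).symm (G.adj_comm _ _)
      · have hx' : x ∈ T \ C := by simp [hx, hxC]
        have hy' : y ∈ T \ C := by simp [hy, hyC]
        by_cases hL : lab x = lab y
        · rw [hFT x hx', hFT y hy', ← hL]
          exact (hf (lab x)).2.1 x (by simpa using ⟨hx, hxC⟩) y (by simpa [hL] using ⟨hy, hyC⟩) hxy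
        · refine Good.of_disj (hlab x hx' y hy' hL) ?_
          obtain ⟨_, h2⟩ := hfok x hx'
          obtain ⟨_, h4⟩ := hfok y hy'
          rcases hfin3 (lab x) with h | h | h <;> rcases hfin3 (lab y) with h' | h' | h' <;>
            rw [h, h'] at hL <;> rw [h] at h2 <;> rw [h'] at h4 <;>
            simp [regBx, Bx.mem] at hL h2 h4 ⊢ <;> intros <;> omega
  · intro x hx
    by_cases hxC : x ∈ C
    · rw [hFC x hxC]
      have hxv : x ≠ v := fun h => hv (h ▸ hx)
      have u := huniq x (Or.inl hxC) v (Or.inr rfl) hxv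
      have u0 := u 0
      have c1 := hC0 x hxC
      have c2 := hcross x hxC
      have key : Good ⟨0, B + 1 + (if own v 0 then B + l 0 else 0), -0, 0⟩ (bC x) (G.Adj v x) := by
        apply pt_good (hvC x hxC)
        · omega
        · split_ifs <;> omega
        · exact le_rfl
        · exact le_rfl
        iterate 3 (split_ifs <;> omega)
        · exact hor _ _ _ _ fun h1 h2 => u0 h2 h1
        · left; rfl
        · left; rfl
        · right; exact ⟨rfl, rfl⟩
        · by_cases h : own x 0
          · right; simp [c1 h]
          · left; simp [h]
        · right
          refine ⟨rfl, rfl, ?_⟩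
          by_cases h : own v 0
          · by_cases h' : own x 1
            · right; right; exact if_neg fun h2 => c2 h h' h2
            · right; left; simp [h']
          · left; simp [h]
      simpa using key
    · have hx' : x ∈ T \ C := by simp [hx, hxC]
      obtain ⟨h1, h2⟩ := hfok x hx'
      have h3 := hfN x hx'
      have h4 := hadj x hx' v (Or.inr rfl)
      have key : Good ⟨0, B + 1 + (if own v 0 then B + l 0 else 0), -0, 0⟩ (F x) (G.Adj v x) := by
        by_cases ho : own v (lab x)
        · apply arm_own h3 (by rw [h4]; tauto) h2 _ _ _ _ (by omega) _ le_rfl le_rfl hl hB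
          · intro h; rw [h] at ho; simp [ho]
          · intro h; rw [h] at ho; exact (hv12.1 ho).elim
          · intro h; rw [h] at ho; exact (hv12.2 ho).elim
          all_goals split_ifs <;> omega
        · apply arm_not (by rw [h4]; tauto) h2 _ _ _ _ le_rfl le_rfl hB
          · intro h; rw [h] at ho; simp [ho]
          · intro h; rfl
          · intro h; rfl
      simpa using key

theorem no_cycle {V : Type*} {G : SimpleGraph V} (hch : Chordal G) (n : ℕ) (hn : 4 ≤ n) (c : ℕ → V)
    (h : ∀ i j, i < j → j < n → c i ≠ c j ∧ (G.Adj (c i) (c j) ↔ (j = i + 1 ∨ (i = 0 ∧ j + 1 = n)))) :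
    False := by
  refine (hch n hn).false ⟨⟨fun i => c i.val, ?_⟩, ?_⟩
  · intro i j hij
    by_contra hne
    have : i.val ≠ j.val := fun h => hne (Fin.ext h)
    rcases lt_or_gt_of_ne this with h1 | h1
    · exact (h _ _ h1 j.2).1 hij
    · exact (h _ _ h1 i.2).1 hij.symm
  · intro i j
    show G.Adj (c i.val) (c j.val) ↔ _
    rw [cycleGraph_adj']
    have hi := i.2
    have hj := j.2
    rcases lt_trichotomy i.val j.val with h1 | h1 | h1
    · rw [(h _ _ h1 j.2).2, Fin.sub_def, Fin.sub_def]
      simp only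
      have e1 : (n - j.val + i.val) % n = n - j.val + i.val := Nat.mod_eq_of_lt (by omega)
      have e2 : (n - i.val + j.val) % n = j.val - i.val := by
        rw [show n - i.val + j.val = (j.val - i.val) + n by omega, Nat.add_mod_right]
        exact Nat.mod_eq_of_lt (by omega)
      rw [e1, e2]
      omega
    · have : i = j := Fin.ext h1
      subst this
      have e2 : (n - i.val + i.val) % n = 0 := by
        rw [show n - i.val + i.val = n by omega, Nat.mod_self]
      rw [Fin.sub_def]
      simp [e2]
    · rw [G.adj_comm, (h _ _ h1 i.2).2, Fin.sub_def, Fin.sub_def]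
      simp only
      have e1 : (n - i.val + j.val) % n = n - i.val + j.val := Nat.mod_eq_of_lt (by omega)
      have e2 : (n - j.val + i.val) % n = i.val - j.val := by
        rw [show n - j.val + i.val = (i.val - j.val) + n by omega, Nat.add_mod_right]
        exact Nat.mod_eq_of_lt (by omega)
      rw [e1, e2]
      omega

inductive Dr where
  | E
  | N
  | W
  | S

def dirP : Dr → ℤ → ℤ → ℤ → ℤ → Prop
  | .E, a, b, s, t => t = b ∧ a < s
  | .N, a, b, s, t => s = a ∧ b < t
  | .W, a, b, s, t => t = b ∧ s < a
  | .S, a, b, s, t => s = a ∧ t < b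

theorem dirP_uniq {e e' : Dr} {a b s t : ℤ} (h : dirP e a b s t) (h' : dirP e' a b s t) :
    e = e' := by
  cases e <;> cases e' <;> simp only [dirP] at * <;> omega

theorem dirP_ex {A : Bx} (hA : A.ok) {a b s t : ℤ} (h : A.mem a b) (h' : A.mem s t)
    (hne : ¬ (s = a ∧ t = b)) : ∃ e, dirP e a b s t := by
  simp only [Bx.ok, Bx.mem] at *
  by_cases h1 : s = a
  · by_cases h2 : b < t
    · exact ⟨.N, h1, h2⟩
    · exact ⟨.S, h1, by omega⟩
  · by_cases h2 : a < s
    · exact ⟨.E, by omega, h2⟩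
    · exact ⟨.W, by omega, by omega⟩

theorem own_uniq {A B : Bx} {P : Prop} (h : Good A B P) {e : Dr} {a b s t s' t' : ℤ}
    (hA : A.mem a b) (hB : B.mem a b) (hA' : A.mem s t) (hB' : B.mem s' t')
    (d : dirP e a b s t) (d' : dirP e a b s' t') : False := by
  cases e
  · have := h.sub a b (a + 1) b hA hB
    simp only [dirP, Bx.mem] at *
    omega
  · have := h.sub a b a (b + 1) hA hB
    simp only [dirP, Bx.mem] at *
    omega
  · have := h.sub a b (a - 1) b hA hB
    simp only [dirP, Bx.mem] at *
    omega
  · have := h.sub a b a (b - 1) hA hB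
    simp only [dirP, Bx.mem] at *
    omega

theorem helly {A B C : Bx} {s t s' t' s'' t'' : ℤ} (h1 : A.mem s t) (h2 : B.mem s t)
    (h3 : A.mem s' t') (h4 : C.mem s' t') (h5 : B.mem s'' t'') (h6 : C.mem s'' t'') :
    ∃ x y, A.mem x y ∧ B.mem x y ∧ C.mem x y := by
  refine ⟨max A.x1 (max B.x1 C.x1), max A.y1 (max B.y1 C.y1), ?_⟩
  simp only [Bx.mem] at *
  omega

theorem sep {V : Type*} {G : SimpleGraph V} (hch : Chordal G) (g : V → Bx)
    (hok : ∀ x, (g x).ok)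
    (hg : ∀ x y, x ≠ y → Good (g x) (g y) (G.Adj x y)) (K M : V → Prop) (a b : ℤ)
    (hM : ∀ w, M w → (g w).mem a b) (hK : ∀ x, K x → ¬ (g x).mem a b)
    (tch : V → Dr → Prop)
    (htch : ∀ x e, tch x e ↔ ∃ w, M w ∧ ∃ s t, (g w).mem s t ∧ (g x).mem s t ∧ dirP e a b s t) :
    ∀ (k : ℕ) (p : ℕ → V) (e e' : Dr), (∀ i ≤ k, K (p i)) → (∀ i < k, G.Adj (p i) (p (i + 1))) →
      tch (p 0) e → tch (p k) e' → e = e' := by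
  intro k
  induction k using Nat.strong_induction_on with
  | _ k IH =>
  intro p e e' hpK hp he he'
  by_contra hne
  have hKM : ∀ x w, K x → M w → w ≠ x := by
    rintro x w h1 h2 rfl
    exact hK _ h1 (hM _ h2)
  -- adjacency to M members
  have hadj : ∀ u i, i ≤ k → M u → G.Adj u (p i) →
      ∃ e'' s t, (g u).mem s t ∧ (g (p i)).mem s t ∧ dirP e'' a b s t ∧ tch (p i) e'' := by
    intro u i hi hu ha
    obtain ⟨s, t, h1, h2⟩ := (hg u (p i) (hKM _ _ (hpK i hi) hu)).iff.1 ha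
    have : ¬ (s = a ∧ t = b) := by
      rintro ⟨rfl, rfl⟩
      exact hK _ (hpK i hi) h2
    obtain ⟨e'', h3⟩ := dirP_ex (hok u) (hM u hu) h1 this
    exact ⟨e'', s, t, h1, h2, h3, (htch _ _).2 ⟨u, hu, s, t, h1, h2, h3⟩⟩
  have hpre : ∀ i, i < k → ∀ e'', tch (p i) e'' → e = e'' := fun i hi e'' h =>
    IH i hi p e e'' (fun j hj => hpK j (by omega)) (fun j hj => hp j (by omega)) he h
  have hsuf : ∀ i, 0 < i → i ≤ k → ∀ e'', tch (p i) e'' → e'' = e' := fun i hi hik e'' h => by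
    refine IH (k - i) (by omega) (fun n => p (n + i)) e'' e' (fun j hj => hpK _ (by omega))
      (fun j hj => ?_) (by simpa using h) (by simpa [Nat.sub_add_cancel hik] using he')
    have := hp (j + i) (by omega)
    rwa [show j + i + 1 = j + 1 + i by omega] at this
  have hind : ∀ i j, i + 1 < j → j ≤ k → p i ≠ p j ∧ ¬ G.Adj (p i) (p j) := by
    intro i j hij hjk
    constructor
    · intro heq
      apply hne
      refine IH (k - (j - i)) (by omega) (fun n => if n ≤ i then p n else p (n + (j - i))) e e' ?_ ?_ ?_ ?_
      · intro m hm
        split_ifs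
        · exact hpK _ (by omega)
        · exact hpK _ (by omega)
      · intro m hm
        split_ifs with h1 h2 h2
        · exact hp _ (by omega)
        · have : m = i := by omega
          subst this
          rw [heq, show m + 1 + (j - m) = j + 1 by omega]
          exact hp _ (by omega)
        · omega
        · rw [show m + 1 + (j - i) = m + (j - i) + 1 by omega]
          exact hp _ (by omega)
      · simpa using he
      · split_ifs with h1
        · have : j = k := by omega
          rw [show k - (j - i) = i by omega, heq, this]; exact he'
        · rw [show k - (j - i) + (j - i) = k by omega]; exact he'
    · intro heq
      apply hne
      refine IH (k - (j - i - 1)) (by omega)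
        (fun n => if n ≤ i then p n else p (n + (j - i - 1))) e e' ?_ ?_ ?_ ?_
      · intro m hm
        split_ifs
        · exact hpK _ (by omega)
        · exact hpK _ (by omega)
      · intro m hm
        split_ifs with h1 h2 h2
        · exact hp _ (by omega)
        · have : m = i := by omega
          subst this
          rw [show m + 1 + (j - m - 1) = j by omega]
          exact heq
        · omega
        · rw [show m + 1 + (j - i - 1) = m + (j - i - 1) + 1 by omega]
          exact hp _ (by omega)
      · simpa using he
      · split_ifs with h1
        · omega
        · rw [show k - (j - i - 1) + (j - i - 1) = k by omega]; exact he'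
  have hpadj : ∀ i j, i < j → j ≤ k → p i ≠ p j ∧ (G.Adj (p i) (p j) ↔ j = i + 1) := by
    intro i j hij hj
    by_cases h : j = i + 1
    · subst h
      have := hp i (by omega)
      exact ⟨this.ne, by simpa using this⟩
    · have := hind i j (by omega) hj
      exact ⟨this.1, by simp [this.2, h]⟩
  obtain ⟨w, hw, s, t, hws, hps, hd⟩ := (htch _ _).1 he
  obtain ⟨w', hw', s', t', hws', hps', hd'⟩ := (htch _ _).1 he'
  have hmid : ∀ u i, M u → 0 < i → i < k → ¬ G.Adj u (p i) := by
    intro u i hu h0 hik ha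
    obtain ⟨e'', _, _, _, _, _, h⟩ := hadj u i hik.le hu ha
    exact hne ((hpre i hik _ h).trans (hsuf i h0 hik.le _ h))
  have hfirst : ∀ u, M u → 0 < k → G.Adj u (p 0) → u = w := by
    intro u hu h0 ha
    obtain ⟨e'', s2, t2, m1, m2, m3, h⟩ := hadj u 0 h0.le hu ha
    have := hpre 0 h0 _ h
    subst this
    by_contra huw
    exact own_uniq (hg u w huw) (hM u hu) (hM w hw) m1 hws m3 hd
  have hlast : ∀ u, M u → 0 < k → G.Adj u (p k) → u = w' := by
    intro u hu h0 ha
    obtain ⟨e'', s2, t2, m1, m2, m3, h⟩ := hadj u k le_rfl hu ha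
    have := hsuf k h0 le_rfl _ h
    subst this
    by_contra huw
    exact own_uniq (hg u w' huw) (hM u hu) (hM w' hw') m1 hws' m3 hd'
  have hwne : ∀ i ≤ k, ∀ u, M u → u ≠ p i := fun i hi u hu => hKM _ _ (hpK i hi) hu
  have hwp : G.Adj w (p 0) := (hg _ _ (hwne 0 (by omega) w hw)).iff.2 ⟨s, t, hws, hps⟩
  have hwp' : G.Adj w' (p k) := (hg _ _ (hwne k le_rfl w' hw')).iff.2 ⟨s', t', hws', hps'⟩
  by_cases hww : w = w'
  · subst hww
    rcases Nat.lt_or_ge k 2 with hk | hk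
    · have hcom : ∃ x y, (g w).mem x y ∧ (g (p 0)).mem x y ∧ (g (p k)).mem x y := by
        rcases Nat.eq_zero_or_pos k with h | h
        · subst h; exact ⟨s, t, hws, hps, hps⟩
        · have : k = 1 := by omega
          subst this
          obtain ⟨s2, t2, h1, h2⟩ := (hg _ _ (hp 0 (by omega)).ne).iff.1 (hp 0 (by omega))
          exact helly hws hps hws' hps' h1 h2
      obtain ⟨x, y, h1, h2, h3⟩ := hcom
      obtain ⟨rfl, rfl⟩ := (hg _ _ (hwne 0 (by omega) w hw)).sub _ _ _ _ hws hps h1 h2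
      obtain ⟨rfl, rfl⟩ := (hg _ _ (hwne k le_rfl w hw)).sub _ _ _ _ hws' hps' h1 h3
      exact hne (dirP_uniq hd hd')
    · refine no_cycle hch (k + 2) (by omega) (fun n => if n = 0 then w else p (n - 1)) ?_
      intro i j hij hj
      have hj0 : j ≠ 0 := by omega
      by_cases hi : i = 0
      · subst hi
        simp only [if_true, if_neg hj0]
        refine ⟨hwne _ (by omega) w hw, ?_⟩
        by_cases h1 : j = 1
        · subst h1; simpa using hwp
        · by_cases h2 : j = k + 1
          · subst h2; simpa using hwp'
          · have := hmid w (j - 1) hw (by omega) (by omega)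
            simp only [this, false_iff]; omega
      · simp only [if_neg hi, if_neg hj0]
        have := hpadj (i - 1) (j - 1) (by omega) (by omega)
        refine ⟨this.1, this.2.trans ?_⟩
        omega
  · have hadjww : G.Adj w w' := (hg _ _ hww).iff.2 ⟨a, b, hM _ hw, hM _ hw'⟩
    rcases Nat.eq_zero_or_pos k with hk | hk
    · subst hk
      obtain ⟨x, y, h1, h2, h3⟩ := helly hws hps (hM _ hw) (hM _ hw') hps' hws'
      obtain ⟨rfl, rfl⟩ := (hg _ _ hww).sub _ _ _ _ h1 h3 (hM _ hw) (hM _ hw')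
      exact hK _ (hpK 0 le_rfl) h2
    · refine no_cycle hch (k + 3) (by omega)
        (fun n => if n = 0 then w else if n = k + 2 then w' else p (n - 1)) ?_
      intro i j hij hj
      have hj0 : j ≠ 0 := by omega
      have hik : i ≠ k + 2 := by omega
      by_cases hi : i = 0
      · subst hi
        by_cases hjk : j = k + 2
        · subst hjk
          simp only [if_true, if_neg hj0]
          exact ⟨hww, by simpa using hadjww⟩
        · simp only [if_true, if_neg hj0, if_neg hjk]
          refine ⟨hwne _ (by omega) w hw, ?_⟩
          by_cases h1 : j = 1
          · subst h1; simpa using hwp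
          · have : ¬ G.Adj w (p (j - 1)) := by
              by_cases h2 : j = k + 1
              · subst h2
                exact fun h => hww (hlast w hw hk (by simpa using h))
              · exact hmid w (j - 1) hw (by omega) (by omega)
            simp only [this, false_iff]; omega
      · by_cases hjk : j = k + 2
        · subst hjk
          simp only [if_true, if_neg hj0, if_neg hi, if_neg hik]
          refine ⟨(hwne _ (by omega) w' hw').symm, ?_⟩
          rw [G.adj_comm]
          by_cases h1 : i = k + 1
          · subst h1; simpa using hwp'
          · have : ¬ G.Adj w' (p (i - 1)) := by
              by_cases h2 : i = 1
              · subst h2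
                exact fun h => hww (hfirst w' hw' hk (by simpa using h)).symm
              · exact hmid w' (i - 1) hw' (by omega) (by omega)
            simp only [this, false_iff]; omega
        · simp only [if_neg hi, if_neg hj0, if_neg hjk, if_neg hik]
          have := hpadj (i - 1) (j - 1) (by omega) (by omega)
          refine ⟨this.1, this.2.trans ?_⟩
          omega

def dr : Dr → Fin 3 → Dr
  | .E => ![.E, .N, .S]
  | .N => ![.N, .W, .E]
  | .W => ![.W, .S, .N]
  | .S => ![.S, .E, .W]

def op : Dr → Dr
  | .E => .W
  | .N => .S
  | .W => .E
  | .S => .N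

theorem dr_inj (d : Dr) (i j : Fin 3) (h : dr d i = dr d j) : i = j := by
  cases d <;> fin_cases i <;> fin_cases j <;> simp [dr] at *

theorem dr_cover (d e : Dr) (h : e ≠ op d) : ∃ i, e = dr d i := by
  have : e = dr d 0 ∨ e = dr d 1 ∨ e = dr d 2 := by
    cases d <;> cases e <;> simp [dr, op] at *
  rcases this with h | h | h
  exacts [⟨0, h⟩, ⟨1, h⟩, ⟨2, h⟩]

theorem own_two {A : Bx} (hA : A.ok) {e e' : Dr} {a b s t s' t' : ℤ}
    (h1 : A.mem a b) (h2 : A.mem s t) (h3 : A.mem s' t') (d1 : dirP e a b s t)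
    (d2 : dirP e' a b s' t') : e' = e ∨ e' = op e := by
  cases e <;> cases e' <;> simp only [dirP, op, Bx.ok, Bx.mem] at * <;> first | omega | simp

theorem not_cor {A : Bx} {e : Dr} {a b s t s' t' : ℤ}
    (h2 : A.mem s t) (h3 : A.mem s' t') (d1 : dirP e a b s t)
    (d2 : dirP (op e) a b s' t') : ¬ A.cor a b := by
  cases e <;> simp only [dirP, op, Bx.cor, Bx.mem] at * <;> omega

theorem nearest {d : Dr} {a b s0 t0 s t : ℤ} (h0 : dirP d a b s0 t0) (h : dirP d a b s t)
    (hm : (s0 - a).toNat + (a - s0).toNat + (t0 - b).toNat + (b - t0).toNat ≤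
      (s - a).toNat + (a - s).toNat + (t - b).toNat + (b - t).toNat)
    (hne : ¬ (s = s0 ∧ t = t0)) : dirP d s0 t0 s t := by
  cases d <;> simp only [dirP] at * <;> omega

theorem dirP_op {d : Dr} {a b s t : ℤ} (h : dirP d a b s t) : dirP (op d) s t a b := by
  cases d <;> simp only [dirP, op] at * <;> omega

open Classical in
theorem arm_main {V : Type*} {G : SimpleGraph V} (hch : Chordal G) (g : V → Bx)
    (hok : ∀ x, (g x).ok)
    (hg : ∀ x y, x ≠ y → Good (g x) (g y) (G.Adj x y)) (T : Finset V) :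
    ∀ (v : V) (a b : ℤ) (d : Dr), v ∉ T → (g v).mem a b →
      (∀ x ∈ T, ∀ s t, (g x).mem s t → (g v).mem s t → dirP d a b s t) →
      ArmSpec G T (fun x => G.Adj v x) := by
  induction T using Finset.strongInduction with
  | H T IH =>
  intro v a b d hvT hvab hdir
  by_cases hnone : ∀ x ∈ T, ¬ G.Adj v x
  · exact ArmSpec.trivial g hok hg T _ hnone
  push Not at hnone
  have hTv : ∀ x ∈ T, v ≠ x := by rintro x hx rfl; exact hvT hx
  have hex : ∃ m : ℕ, ∃ x ∈ T, ∃ s t, (g x).mem s t ∧ (g v).mem s t ∧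
      m = (s - a).toNat + (a - s).toNat + (t - b).toNat + (b - t).toNat := by
    obtain ⟨x, hx, ha⟩ := hnone
    obtain ⟨s, t, h1, h2⟩ := (hg v x (hTv x hx)).iff.1 ha
    exact ⟨_, x, hx, s, t, h2, h1, rfl⟩
  obtain ⟨x0, hx0, s0, t0, hx0q, hvq, hm⟩ := Nat.find_spec hex
  have hd0 := hdir x0 hx0 s0 t0 hx0q hvq
  have hnear : ∀ x ∈ T, ∀ s t, (g x).mem s t → (g v).mem s t → ¬ (s = s0 ∧ t = t0) →
      dirP d s0 t0 s t := by
    intro x hx s t h1 h2 hne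
    refine nearest hd0 (hdir x hx s t h1 h2) ?_ hne
    rw [← hm]
    exact Nat.find_min' hex ⟨x, hx, s, t, h1, h2, rfl⟩
  have hvop : dirP (op d) s0 t0 a b := dirP_op hd0
  set C := T.filter fun x => (g x).mem s0 t0 with hC
  set M : V → Prop := fun w => w ∈ C ∨ w = v with hM
  set K : V → Prop := fun x => x ∈ T \ C with hK
  have hMq : ∀ w, M w → (g w).mem s0 t0 := by
    rintro w (h | rfl)
    · exact (Finset.mem_filter.1 h).2
    · exact hvq
  have hKT : ∀ x, K x → x ∈ T := fun x h => (Finset.mem_sdiff.1 h).1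
  have hKq : ∀ x, K x → ¬ (g x).mem s0 t0 := by
    intro x h hq
    have := Finset.mem_sdiff.1 h
    exact this.2 (Finset.mem_filter.2 ⟨this.1, hq⟩)
  have hKM : ∀ x w, K x → M w → w ≠ x := by
    rintro x w h1 h2 rfl
    exact hKq _ h1 (hMq _ h2)
  let tch : V → Dr → Prop := fun x e =>
    ∃ w, M w ∧ ∃ s t, (g w).mem s t ∧ (g x).mem s t ∧ dirP e s0 t0 s t
  have hsep := sep hch g hok hg K M s0 t0 hMq hKq tch (fun _ _ => Iff.rfl)
  let L : V → Fin 3 → Prop := fun x i => ∃ (k : ℕ) (p : ℕ → V), (∀ j ≤ k, K (p j)) ∧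
    (∀ j < k, G.Adj (p j) (p (j + 1))) ∧ p 0 = x ∧ tch (p k) (dr d i)
  let lab : V → Fin 3 := fun x => if L x 1 then 1 else if L x 2 then 2 else 0
  have hLadj : ∀ x y i, K x → G.Adj x y → L y i → L x i := by
    rintro x y i hx hxy ⟨k, p, h1, h2, h3, h4⟩
    refine ⟨k + 1, fun n => if n = 0 then x else p (n - 1), ?_, ?_, by simp, by simpa using h4⟩
    · intro j hj
      dsimp only
      split_ifs
      · exact hx
      · exact h1 _ (by omega)
    · intro j hj
      by_cases hj0 : j = 0
      · subst hj0; simpa [h3] using hxy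
      · have := h2 (j - 1) (by omega)
        rw [Nat.sub_add_cancel (by omega)] at this
        simpa [hj0] using this
  have hlabadj : ∀ x y, K x → K y → G.Adj x y → lab x = lab y := by
    intro x y hx hy hxy
    have : ∀ i, L x i = L y i := fun i =>
      propext ⟨hLadj y x i hy hxy.symm, hLadj x y i hx hxy⟩
    simp only [lab, this]
  have hL1 : ∀ x i j, K x → tch x (dr d i) → L x j → i = j := by
    rintro x i j hx ht ⟨k, p, h1, h2, rfl, h4⟩
    exact dr_inj d i j (hsep k p _ _ h1 h2 ht h4)
  have hlabt : ∀ x i, K x → tch x (dr d i) → lab x = i := by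
    intro x i hx ht
    have hL : L x i := ⟨0, fun _ => x, fun _ _ => hx, fun j hj => by omega, rfl, ht⟩
    have h1 := hL1 x i 1 hx ht
    have h2 := hL1 x i 2 hx ht
    have hfin3 : ∀ i : Fin 3, i = 0 ∨ i = 1 ∨ i = 2 := by decide
    simp only [lab]
    rcases hfin3 i with rfl | rfl | rfl
    · rw [if_neg (fun h => absurd (h1 h) (by decide)), if_neg (fun h => absurd (h2 h) (by decide))]
    · rw [if_pos hL]
    · rw [if_neg (fun h => absurd (h1 h) (by decide)), if_pos hL]
  have hMuniq : ∀ w, M w → ∀ w', M w' → w ≠ w' → ∀ e s t s' t', (g w).mem s t →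
      (g w').mem s' t' → dirP e s0 t0 s t → dirP e s0 t0 s' t' → False := by
    intro w hw w' hw' hne e s t s' t' h1 h2 h3 h4
    exact own_uniq (hg w w' hne) (hMq w hw) (hMq w' hw') h1 h2 h3 h4
  -- every contact of x in K with w in M is in direction dr d (lab x)
  have hcontact : ∀ x w s t, K x → M w → (g w).mem s t → (g x).mem s t →
      dirP (dr d (lab x)) s0 t0 s t := by
    intro x w s t hx hw h1 h2
    have hne : ¬ (s = s0 ∧ t = t0) := by
      rintro ⟨rfl, rfl⟩; exact hKq x hx h2
    obtain ⟨e, he⟩ := dirP_ex (hok w) (hMq w hw) h1 hne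
    have heop : e ≠ op d := by
      rintro rfl
      have hwv : w = v := by
        by_contra hwv
        exact hMuniq w hw v (Or.inr rfl) hwv _ _ _ _ _ h1 hvab he hvop
      subst hwv
      have := dirP_uniq he (hnear x (hKT x hx) s t h2 h1 hne)
      cases d <;> simp [op] at this
    obtain ⟨i, rfl⟩ := dr_cover d e heop
    rw [hlabt x i hx ⟨w, hw, s, t, h1, h2, he⟩]
    exact he
  let own : V → Fin 3 → Prop := fun w i => ∃ s t, (g w).mem s t ∧ dirP (dr d i) s0 t0 s t
  let N : Fin 3 → V → Prop := fun i x => ∃ w, M w ∧ own w i ∧ G.Adj w x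
  have huniq : ∀ w, M w → ∀ w', M w' → w ≠ w' → ∀ i, own w i → own w' i → False := by
    rintro w hw w' hw' hne i ⟨s, t, h1, h2⟩ ⟨s', t', h3, h4⟩
    exact hMuniq w hw w' hw' hne _ _ _ _ _ h1 h3 h2 h4
  have htwo : ∀ w, M w → ∀ e e' s t s' t', (g w).mem s t → (g w).mem s' t' → dirP e s0 t0 s t →
      dirP e' s0 t0 s' t' → e' = e ∨ e' = op e := fun w hw e e' s t s' t' h1 h2 h3 h4 =>
    own_two (hok w) (hMq w hw) h1 h2 h3 h4
  refine glue T C v hvT (Finset.filter_subset _ _) lab own N ?_ ?_ ?_ ?_ ?_ huniq ?_ ?_ ?_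
  · intro x hx y hy hxy
    exact (hg x y hxy).iff.2 ⟨s0, t0, hMq x (Or.inl hx), hMq y (Or.inl hy)⟩
  · intro x hx
    exact (hg v x (hTv x (Finset.mem_filter.1 hx).1)).iff.2 ⟨s0, t0, hvq, hMq x (Or.inl hx)⟩
  · intro x hx y hy hne ha
    exact hne (hlabadj x y hx hy ha)
  · intro x hx w hw
    constructor
    · intro ha
      obtain ⟨s, t, h1, h2⟩ := (hg w x (hKM x w hx hw)).iff.1 ha
      have ho : own w (lab x) := ⟨s, t, h1, hcontact x w s t hx hw h1 h2⟩
      exact ⟨ho, w, hw, ho, ha⟩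
    · rintro ⟨ho, w', hw', ho', ha⟩
      by_cases h : w = w'
      · rw [h]; exact ha
      · exact (huniq w hw w' hw' h _ ho ho').elim
  · intro i
    by_cases hw : ∃ w, M w ∧ own w i
    · obtain ⟨w, hw, ho⟩ := hw
      have hss : (T \ C).filter (fun x => lab x = i) ⊂ T := by
        refine ⟨fun x hx => hKT x (Finset.mem_filter.1 hx).1, fun h => ?_⟩
        exact hKq x0 (Finset.mem_filter.1 (h hx0)).1 hx0q
      have hwn : w ∉ (T \ C).filter (fun x => lab x = i) := fun h =>
        hKM w w (Finset.mem_filter.1 h).1 hw rfl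
      refine (IH _ hss w s0 t0 (dr d i) hwn (hMq w hw) ?_).congr ?_
      · intro x hx s t h1 h2
        obtain ⟨hx1, hx2⟩ := Finset.mem_filter.1 hx
        rw [← hx2]
        exact hcontact x w s t hx1 hw h2 h1
      · intro x hx
        constructor
        · intro ha; exact ⟨w, hw, ho, ha⟩
        · rintro ⟨w', hw', ho', ha⟩
          by_cases h : w = w'
          · rw [h]; exact ha
          · exact (huniq w hw w' hw' h _ ho ho').elim
    · refine ArmSpec.trivial g hok hg _ _ ?_
      rintro x hx ⟨w, h1, h2, _⟩
      exact hw ⟨w, h1, h2⟩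
  · rintro x hx ⟨s, t, h1, h2⟩
    constructor
    · rintro ⟨s', t', h3, h4⟩
      have := htwo x (Or.inl hx) _ _ _ _ _ _ h1 h3 h2 h4
      cases d <;> simp [dr, op] at this
    · rintro ⟨s', t', h3, h4⟩
      have := htwo x (Or.inl hx) _ _ _ _ _ _ h1 h3 h2 h4
      cases d <;> simp [dr, op] at this
  · constructor
    · rintro ⟨s', t', h3, h4⟩
      have := htwo v (Or.inr rfl) _ _ _ _ _ _ hvab h3 hvop h4
      cases d <;> simp [dr, op] at this
    · rintro ⟨s', t', h3, h4⟩
      have := htwo v (Or.inr rfl) _ _ _ _ _ _ hvab h3 hvop h4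
      cases d <;> simp [dr, op] at this
  · rintro x hx ⟨s, t, h1, h2⟩ ⟨s', t', h3, h4⟩ ⟨s'', t'', h5, h6⟩
    have e0 : dr d 0 = d := by cases d <;> rfl
    have e2 : dr d 2 = op (dr d 1) := by cases d <;> rfl
    rw [e0] at h2
    rw [e2] at h6
    rcases (hg v x (hTv x (Finset.mem_filter.1 hx).1)).cor s0 t0 hvq (hMq x (Or.inl hx)) with h | h
    · exact not_cor h1 hvab h2 hvop h
    · exact not_cor h3 h5 h4 h6 h

def Bx.set (A : Bx) : Set (ℤ × ℤ) := {p | A.mem p.1 p.2}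

theorem seg_to_bx {S : Set (ℤ × ℤ)} (h : IsGridSegment S) : ∃ A : Bx, A.ok ∧ S = A.set := by
  rcases h with ⟨y, a, b, hab, rfl⟩ | ⟨x, a, b, hab, rfl⟩
  · refine ⟨⟨a, b, y, y⟩, ⟨by simp [hab], by simp [hab], by simp⟩, ?_⟩
    ext ⟨s, t⟩
    simp only [Bx.set, Bx.mem, Set.mem_ofPred_eq]
    omega
  · refine ⟨⟨x, x, a, b⟩, ⟨by simp [hab], by simp [hab], by simp⟩, ?_⟩
    ext ⟨s, t⟩
    simp only [Bx.set, Bx.mem, Set.mem_ofPred_eq]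
    omega

theorem bx_seg {A : Bx} (h : A.ok) : IsGridSegment A.set := by
  obtain ⟨h1, h2, h3 | h3⟩ := h
  · right
    refine ⟨A.x1, A.y1, A.y2, h2, ?_⟩
    ext ⟨s, t⟩
    simp only [Bx.set, Bx.mem, Set.mem_ofPred_eq]
    omega
  · left
    refine ⟨A.y1, A.x1, A.x2, h1, ?_⟩
    ext ⟨s, t⟩
    simp only [Bx.set, Bx.mem, Set.mem_ofPred_eq]
    omega

theorem cor_of_end {A : Bx} (h : A.ok) {p : ℤ × ℤ} (hp : IsEndpointOf p A.set) :
    A.cor p.1 p.2 := by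
  obtain ⟨h1, h2, -⟩ := h
  have key : ∀ B : Bx, B.x1 ≤ B.x2 → B.y1 ≤ B.y2 → A.set = B.set → A = B := by
    intro B b1 b2 hs
    have e1 : ∀ s t, A.mem s t ↔ B.mem s t := fun s t =>
      ⟨fun h => (hs ▸ (show (s, t) ∈ A.set from h) : (s, t) ∈ B.set),
       fun h => (hs ▸ (show (s, t) ∈ B.set from h) : (s, t) ∈ A.set)⟩
    have c1 := (e1 A.x1 A.y1).1 (by simp only [Bx.mem]; omega)
    have c2 := (e1 A.x2 A.y2).1 (by simp only [Bx.mem]; omega)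
    have c3 := (e1 B.x1 B.y1).2 (by simp only [Bx.mem]; omega)
    have c4 := (e1 B.x2 B.y2).2 (by simp only [Bx.mem]; omega)
    cases A
    cases B
    simp only [Bx.mem, Bx.mk.injEq] at *
    omega
  rcases hp with ⟨y, a, b, hab, hS, hp⟩ | ⟨x, a, b, hab, hS, hp⟩
  · have := key ⟨a, b, y, y⟩ hab le_rfl (by
      rw [hS]
      ext ⟨s, t⟩
      simp only [Bx.set, Bx.mem, Set.mem_ofPred_eq]
      omega)
    rw [this]
    rcases hp with rfl | rfl <;> simp [Bx.cor]
  · have := key ⟨x, x, a, b⟩ le_rfl hab (by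
      rw [hS]
      ext ⟨s, t⟩
      simp only [Bx.set, Bx.mem, Set.mem_ofPred_eq]
      omega)
    rw [this]
    rcases hp with rfl | rfl <;> simp [Bx.cor]

theorem end_of_cor {A : Bx} (h : A.ok) {p : ℤ × ℤ} (hp : A.cor p.1 p.2) :
    IsEndpointOf p A.set := by
  obtain ⟨s, t⟩ := p
  obtain ⟨h1, h2, h3 | h3⟩ := h
  · right
    refine ⟨A.x1, A.y1, A.y2, h2, ?_, ?_⟩
    · ext ⟨s, t⟩
      simp only [Bx.set, Bx.mem, Set.mem_ofPred_eq]
      omega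
    · simp only [Bx.cor, Prod.mk.injEq] at *
      omega
  · left
    refine ⟨A.y1, A.x1, A.x2, h1, ?_, ?_⟩
    · ext ⟨s, t⟩
      simp only [Bx.set, Bx.mem, Set.mem_ofPred_eq]
      omega
    · simp only [Bx.cor, Prod.mk.injEq] at *
      omega

theorem cor_dir {A : Bx} (h : A.ok) {a b : ℤ} (hc : A.cor a b) :
    ∃ d, ∀ s t, A.mem s t → ¬ (s = a ∧ t = b) → dirP d a b s t := by
  simp only [Bx.ok, Bx.cor, Bx.mem] at *
  by_cases h1 : A.x1 = A.x2
  · by_cases h2 : b = A.y1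
    · refine ⟨.N, fun s t => ?_⟩
      simp only [dirP]
      omega
    · refine ⟨.S, fun s t => ?_⟩
      simp only [dirP]
      omega
  · by_cases h2 : a = A.x1
    · refine ⟨.E, fun s t => ?_⟩
      simp only [dirP]
      omega
    · refine ⟨.W, fun s t => ?_⟩
      simp only [dirP]
      omega

/-- Build a representation from boxes. -/
def repOfBx {V : Type*} {G : SimpleGraph V} (g : V → Bx) (hok : ∀ x, (g x).ok)
    (hg : ∀ x y, x ≠ y → Good (g x) (g y) (G.Adj x y)) : ContactB0VPGRep G where
  seg := fun x => (g x).set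
  isSeg := fun x => bx_seg (hok x)
  adj_iff := fun x y h => by
    rw [(hg x y h).iff]
    constructor
    · rintro ⟨s, t, h1, h2⟩; exact ⟨(s, t), h1, h2⟩
    · rintro ⟨⟨s, t⟩, h1, h2⟩; exact ⟨s, t, h1, h2⟩
  inter_subsingleton := fun x y h => by
    rintro ⟨s, t⟩ ⟨h1, h2⟩ ⟨s', t'⟩ ⟨h3, h4⟩
    have := (hg x y h).sub s t s' t' h1 h2 h3 h4
    exact Prod.ext this.1 this.2
  contact := fun x y h p hp =>
    ((hg x y h).cor p.1 p.2 hp.1 hp.2).imp (end_of_cor (hok x)) (end_of_cor (hok y))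

/-- If `v` is a non-internal vertex of a chordal contact B₀-VPG graph,
then there is a contact B₀-VPG representation in which `P_v` is horizontal, its right
endpoint `(a, y)` is free, and every point of every other segment has first
coordinate strictly smaller than `a`. -/
theorem stmt_4 {V : Type*} [Fintype V] (G : SimpleGraph V) (hch : Chordal G)
    (hc : ContactB0VPG G) (v : V) (hv : ¬ InternalVertex G v) :
    ∃ (R : ContactB0VPGRep G) (y lo a : ℤ), lo ≤ a ∧
      R.seg v = {p : ℤ × ℤ | p.2 = y ∧ lo ≤ p.1 ∧ p.1 ≤ a} ∧
      (∀ w : V, w ≠ v → ((a, y) : ℤ × ℤ) ∉ R.seg w) ∧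
      (∀ w : V, w ≠ v → ∀ p ∈ R.seg w, p.1 < a) := by
  classical
  unfold InternalVertex at hv
  push Not at hv
  obtain ⟨R, ⟨a, b⟩, hend, hfree⟩ := hv
  choose g hok hset using fun x => seg_to_bx (R.isSeg x)
  have hg : ∀ x y, x ≠ y → Good (g x) (g y) (G.Adj x y) := by
    intro x y h
    have h1 := R.adj_iff x y h
    have h2 := R.inter_subsingleton x y h
    have h3 := R.contact x y h
    rw [hset x, hset y] at h1 h2 h3
    refine ⟨?_, ?_, ?_⟩
    · rw [h1]
      constructor
      · rintro ⟨⟨s, t⟩, h1, h2⟩; exact ⟨s, t, h1, h2⟩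
      · rintro ⟨s, t, h1, h2⟩; exact ⟨(s, t), h1, h2⟩
    · intro s t s' t' a1 a2 a3 a4
      have := h2 (show (s, t) ∈ _ from ⟨a1, a2⟩) (show (s', t') ∈ _ from ⟨a3, a4⟩)
      simpa using this
    · intro s t a1 a2
      exact (h3 (s, t) ⟨a1, a2⟩).imp (cor_of_end (hok x)) (cor_of_end (hok y))
  rw [hset v] at hend
  have hcor : (g v).cor a b := cor_of_end (hok v) hend
  obtain ⟨d, hd⟩ := cor_dir (hok v) hcor
  have hvab : (g v).mem a b := by
    have := hok v
    simp only [Bx.cor, Bx.ok, Bx.mem] at *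
    omega
  obtain ⟨f, len, hlen, h1, h2, h3⟩ := arm_main hch g hok hg (Finset.univ.erase v) v a b d
    (by simp) hvab (by
      intro x hx s t m1 m2
      apply hd s t m2
      rintro ⟨rfl, rfl⟩
      apply hfree x (by simpa using hx)
      rw [hset x]; exact m1)
  let F : V → Bx := fun x => if x = v then ⟨-len, 0, 0, 0⟩ else (f x).refl
  have hFv : F v = ⟨-len, 0, 0, 0⟩ := by simp [F]
  have hFx : ∀ x, x ≠ v → F x = (f x).refl := fun x hx => by simp [F, hx]
  have hFok : ∀ x, (F x).ok := by
    intro x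
    by_cases hx : x = v
    · subst hx; rw [hFv]; simp [Bx.ok, hlen]
    · rw [hFx x hx]
      have := (h1 x (by simpa using hx)).1
      simp only [Bx.ok, Bx.refl] at *
      omega
  have hFg0 : ∀ x, x ≠ v → Good (F v) (F x) (G.Adj v x) := by
    intro x hx
    have := (h3 x (by simpa using hx)).refl
    rw [hFv, hFx x hx]
    simpa [Bx.refl] using this
  have hFg : ∀ x y, x ≠ y → Good (F x) (F y) (G.Adj x y) := by
    intro x y hxy
    by_cases hx : x = v
    · subst hx; exact hFg0 y hxy.symm
    · by_cases hy : y = v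
      · subst hy; exact (hFg0 x hx).symm (G.adj_comm _ _)
      · rw [hFx x hx, hFx y hy]
        exact (h2 x (by simpa using hx) y (by simpa using hy) hxy).refl
  have hneg : ∀ w : V, w ≠ v → ∀ p ∈ (F w).set, p.1 < 0 := by
    intro w hw p hp
    have h4 := (h1 w (by simpa using hw)).2
    rw [hFx w hw] at hp
    simp only [Bx.set, Bx.refl, Bx.mem, Set.mem_ofPred_eq] at hp
    omega
  refine ⟨repOfBx F hFok hFg, 0, -len, 0, by omega, ?_, ?_, ?_⟩
  · show (F v).set = _
    rw [hFv]
    ext ⟨s, t⟩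
    simp only [Bx.set, Bx.mem, Set.mem_ofPred_eq]
    omega
  · intro w hw hp
    exact absurd (hneg w hw _ hp) (lt_irrefl _)
  · intro w hw p hp
    exact hneg w hw p hp
end

section
/- Let G be a chordal contact B₀-VPG finite simple graph and let v be a vertex of G. Then v is internal if and only if in every contact B₀-VPG representation of G, each endpoint p of the segment P_v satisfies at least one of the following: (a) there exists a clique K of G of size 4 with v ∈ K such that p ∈ P_w for every w ∈ K, or (b) there exists an internal vertex w ≠ v such that p ∈ P_w and p is not an endpoint of P_w. -/
open SimpleGraph

namespace CB

def Dir (d : ℤ × ℤ) : Prop := d = (1,0) ∨ d = (-1,0) ∨ d = (0,1) ∨ d = (0,-1)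

def IE (p : ℤ × ℤ) (S : Set (ℤ × ℤ)) : Prop :=
  p ∈ S ∧ ∀ d, Dir d → ¬ (p + d ∈ S ∧ p - d ∈ S)

lemma Dir.neg {d : ℤ × ℤ} (h : Dir d) : Dir (-d) := by
  rcases h with rfl | rfl | rfl | rfl <;> simp [Dir]

lemma Dir.ne {d : ℤ × ℤ} (h : Dir d) : d ≠ 0 := by
  rcases h with rfl | rfl | rfl | rfl <;> simp [Prod.ext_iff]

lemma Dir.odd {d : ℤ × ℤ} (h : Dir d) : (d.1 + d.2) % 2 = 1 := by
  rcases h with rfl | rfl | rfl | rfl <;> simp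

lemma endpoint_iff {S : Set (ℤ × ℤ)} (hS : IsGridSegment S) (p : ℤ × ℤ) :
    IsEndpointOf p S ↔ IE p S := by
  obtain ⟨x, y⟩ := p
  constructor
  · rintro (⟨c, a, b, hab, rfl, h | h⟩ | ⟨c, a, b, hab, rfl, h | h⟩) <;>
    · simp only [Prod.mk.injEq] at h
      obtain ⟨rfl, rfl⟩ := h
      refine ⟨by simp [hab], ?_⟩
      rintro d (rfl | rfl | rfl | rfl) <;> simp
  · rintro ⟨h1, h2⟩
    have ha := h2 (1,0) (by simp [Dir])
    have hb := h2 (0,1) (by simp [Dir])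
    rcases hS with ⟨c, a, b, hab, rfl⟩ | ⟨c, a, b, hab, rfl⟩
    · left
      refine ⟨c, a, b, hab, rfl, ?_⟩
      simp at h1 ha ⊢
      omega
    · right
      refine ⟨c, a, b, hab, rfl, ?_⟩
      simp at h1 hb ⊢
      omega

def dbl (S : Set (ℤ × ℤ)) : Set (ℤ × ℤ) :=
  {x | ∃ m ∈ S, x = m + m ∨ ∃ d, Dir d ∧ m + d ∈ S ∧ x = m + m + d}

lemma even_mem_dbl {S : Set (ℤ × ℤ)} {m : ℤ × ℤ} : m + m ∈ dbl S ↔ m ∈ S := by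
  constructor
  · rintro ⟨n, hn, h | ⟨d, hd, -, h⟩⟩
    · have : m = n := by
        simp only [Prod.ext_iff, Prod.fst_add, Prod.snd_add] at h ⊢
        omega
      rwa [this]
    · have := hd.odd
      simp only [Prod.ext_iff, Prod.fst_add, Prod.snd_add] at h
      omega
  · intro h
    exact ⟨m, h, Or.inl rfl⟩

lemma odd_mem_dbl {S : Set (ℤ × ℤ)} {m d : ℤ × ℤ} (hd : Dir d) :
    m + m + d ∈ dbl S ↔ m ∈ S ∧ m + d ∈ S := by
  constructor
  · rintro ⟨n, hn, h | ⟨d', hd', h', h⟩⟩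
    · have := hd.odd
      simp only [Prod.ext_iff, Prod.fst_add, Prod.snd_add] at h
      omega
    · have key : (m = n ∧ d = d') ∨ (n = m + d ∧ n + d' = m) := by
        rcases hd with rfl | rfl | rfl | rfl <;> rcases hd' with rfl | rfl | rfl | rfl <;>
        simp [Prod.ext_iff] at h ⊢ <;> omega
      rcases key with ⟨rfl, rfl⟩ | ⟨h1, h2⟩
      · exact ⟨hn, h'⟩
      · rw [h2] at h'
        rw [h1] at hn
        exact ⟨h', hn⟩
  · rintro ⟨h1, h2⟩
    exact ⟨m, h1, Or.inr ⟨d, hd, h2, rfl⟩⟩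

lemma dbl_seg {S : Set (ℤ × ℤ)} (hS : IsGridSegment S) : IsGridSegment (dbl S) := by
  rcases hS with ⟨c, a, b, hab, rfl⟩ | ⟨c, a, b, hab, rfl⟩
  · left
    refine ⟨2*c, 2*a, 2*b, by omega, ?_⟩
    ext ⟨x, y⟩
    constructor
    · rintro ⟨⟨m1, m2⟩, hm, h | ⟨d, (rfl | rfl | rfl | rfl), hm', h⟩⟩ <;> simp at hm h ⊢ <;>
       (try simp at hm') <;> omega
    · rintro ⟨h1, h2, h3⟩
      simp at h1 h2 h3
      rcases Int.even_or_odd' x with ⟨k, rfl | rfl⟩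
      · refine ⟨(k, c), ?_, Or.inl ?_⟩ <;> simp <;> omega
      · refine ⟨(k, c), ?_, Or.inr ⟨(1,0), by simp [Dir], ?_, ?_⟩⟩ <;> simp <;> omega
  · right
    refine ⟨2*c, 2*a, 2*b, by omega, ?_⟩
    ext ⟨x, y⟩
    constructor
    · rintro ⟨⟨m1, m2⟩, hm, h | ⟨d, (rfl | rfl | rfl | rfl), hm', h⟩⟩ <;> simp at hm h ⊢ <;>
       (try simp at hm') <;> omega
    · rintro ⟨h1, h2, h3⟩
      simp at h1 h2 h3
      rcases Int.even_or_odd' y with ⟨k, rfl | rfl⟩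
      · refine ⟨(c, k), ?_, Or.inl ?_⟩ <;> simp <;> omega
      · refine ⟨(c, k), ?_, Or.inr ⟨(0,1), by simp [Dir], ?_, ?_⟩⟩ <;> simp <;> omega

lemma dbl_IE {S : Set (ℤ × ℤ)} {m : ℤ × ℤ} : IE (m + m) (dbl S) ↔ IE m S := by
  unfold IE
  rw [even_mem_dbl]
  refine and_congr_right fun h => forall_congr' fun d => imp_congr_right fun hd => ?_
  rw [odd_mem_dbl hd, sub_eq_add_neg, odd_mem_dbl hd.neg, ← sub_eq_add_neg]
  simp [h]

lemma dbl_inter {S S' : Set (ℤ × ℤ)} (h : (S ∩ S').Subsingleton) {x : ℤ × ℤ}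
    (hx : x ∈ dbl S) (hx' : x ∈ dbl S') : ∃ m, m ∈ S ∧ m ∈ S' ∧ x = m + m := by
  obtain ⟨m, hm, rfl | ⟨d, hd, hm', rfl⟩⟩ := hx
  · exact ⟨m, hm, even_mem_dbl.1 hx', rfl⟩
  · have := (odd_mem_dbl hd).1 hx'
    have h2 := h ⟨hm, this.1⟩ ⟨hm', this.2⟩
    exact absurd (by simpa using h2) hd.ne

lemma tri {S : Set (ℤ × ℤ)} (hS : IsGridSegment S) {r : ℤ × ℤ} (hr : r ∈ S) :
    (S = {r} ∧ ∀ d, Dir d → r + d ∉ S) ∨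
    (IE r S ∧ ∃ d0, Dir d0 ∧ ∀ d, Dir d → (r + d ∈ S ↔ d = d0)) ∨
    (¬ IE r S ∧ ∃ d0, Dir d0 ∧ ∀ d, Dir d → (r + d ∈ S ↔ d = d0 ∨ d = -d0)) := by
  obtain ⟨x, y⟩ := r
  have aux : ∀ d0, Dir d0 → (∀ d, Dir d → ((x,y) + d ∈ S ↔ d = d0)) → IE (x,y) S := by
    intro d0 hd0 h
    refine ⟨hr, fun d hd hh => ?_⟩
    rw [sub_eq_add_neg, h d hd, h _ hd.neg] at hh
    obtain ⟨rfl, h2⟩ := hh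
    rcases hd with rfl | rfl | rfl | rfl <;> simp at h2
  have aux2 : ∀ d0, Dir d0 → (∀ d, Dir d → ((x,y) + d ∈ S ↔ d = d0 ∨ d = -d0)) →
      ¬ IE (x,y) S := by
    rintro d0 hd0 h ⟨-, h'⟩
    apply h' d0 hd0
    rw [sub_eq_add_neg, h d0 hd0, h _ hd0.neg]
    simp
  rcases hS with ⟨c, a, b, hab, hS⟩ | ⟨c, a, b, hab, hS⟩
  · have hr' : y = c ∧ a ≤ x ∧ x ≤ b := by rw [hS] at hr; simpa using hr
    by_cases h1 : a = x
    · by_cases h2 : x = b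
      · left
        constructor
        · rw [hS]; ext ⟨s, t⟩; simp; omega
        · rw [hS]; rintro d (rfl | rfl | rfl | rfl) <;> simp <;> omega
      · right; left
        have : ∀ d, Dir d → ((x,y) + d ∈ S ↔ d = (1,0)) := by
          rw [hS]; rintro d (rfl | rfl | rfl | rfl) <;> simp <;> omega
        exact ⟨aux (1,0) (by simp [Dir]) this, (1,0), by simp [Dir], this⟩
    · by_cases h2 : x = b
      · right; left
        have : ∀ d, Dir d → ((x,y) + d ∈ S ↔ d = (-1,0)) := by
          rw [hS]; rintro d (rfl | rfl | rfl | rfl) <;> simp <;> omega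
        exact ⟨aux (-1,0) (by simp [Dir]) this, (-1,0), by simp [Dir], this⟩
      · right; right
        have : ∀ d, Dir d → ((x,y) + d ∈ S ↔ d = (1,0) ∨ d = -(1,0)) := by
          rw [hS]; rintro d (rfl | rfl | rfl | rfl) <;> simp <;> omega
        exact ⟨aux2 (1,0) (by simp [Dir]) this, (1,0), by simp [Dir], this⟩
  · have hr' : x = c ∧ a ≤ y ∧ y ≤ b := by rw [hS] at hr; simpa using hr
    by_cases h1 : a = y
    · by_cases h2 : y = b
      · left
        constructor
        · rw [hS]; ext ⟨s, t⟩; simp; omega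
        · rw [hS]; rintro d (rfl | rfl | rfl | rfl) <;> simp <;> omega
      · right; left
        have : ∀ d, Dir d → ((x,y) + d ∈ S ↔ d = (0,1)) := by
          rw [hS]; rintro d (rfl | rfl | rfl | rfl) <;> simp <;> omega
        exact ⟨aux (0,1) (by simp [Dir]) this, (0,1), by simp [Dir], this⟩
    · by_cases h2 : y = b
      · right; left
        have : ∀ d, Dir d → ((x,y) + d ∈ S ↔ d = (0,-1)) := by
          rw [hS]; rintro d (rfl | rfl | rfl | rfl) <;> simp <;> omega
        exact ⟨aux (0,-1) (by simp [Dir]) this, (0,-1), by simp [Dir], this⟩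
      · right; right
        have : ∀ d, Dir d → ((x,y) + d ∈ S ↔ d = (0,1) ∨ d = -(0,1)) := by
          rw [hS]; rintro d (rfl | rfl | rfl | rfl) <;> simp <;> omega
        exact ⟨aux2 (0,1) (by simp [Dir]) this, (0,1), by simp [Dir], this⟩

lemma ends_dir {S : Set (ℤ × ℤ)} (hS : IsGridSegment S) {r : ℤ × ℤ} (hr : r ∈ S) :
    ∃ f : ℤ × ℤ → ℤ × ℤ, (∀ e, IE e S → e ≠ r → Dir (f e) ∧ r + f e ∈ S) ∧
      (∀ e e', IE e S → IE e' S → e ≠ r → e' ≠ r → f e = f e' → e = e') := by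
  obtain ⟨x, y⟩ := r
  have hE : ∀ e, IE e S ↔ IsEndpointOf e S := fun e => (endpoint_iff hS e).symm
  rcases hS with ⟨c, a, b, hab, hS⟩ | ⟨c, a, b, hab, hS⟩
  · have hr' : y = c ∧ a ≤ x ∧ x ≤ b := by rw [hS] at hr; simpa using hr
    have hE' : ∀ s t, IE (s,t) S → t = c ∧ (s = a ∨ s = b) := by
      rintro s t ⟨h1, h2⟩
      have := h2 (1,0) (by simp [Dir])
      rw [hS] at h1 this
      simp at h1 this
      omega
    refine ⟨fun e => if e.1 < x then (-1,0) else (1,0), ?_, ?_⟩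
    · rintro ⟨s, t⟩ he hne
      have := hE' s t he
      simp at hne ⊢
      split_ifs with h <;> refine ⟨by simp [Dir], ?_⟩ <;> rw [hS] <;> simp <;> omega
    · rintro ⟨s, t⟩ ⟨s', t'⟩ he he' hne hne' hf
      have h1 := hE' s t he
      have h2 := hE' s' t' he'
      simp at hne hne' hf ⊢
      split_ifs at hf <;> simp at hf <;> omega
  · have hr' : x = c ∧ a ≤ y ∧ y ≤ b := by rw [hS] at hr; simpa using hr
    have hE' : ∀ s t, IE (s,t) S → s = c ∧ (t = a ∨ t = b) := by
      rintro s t ⟨h1, h2⟩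
      have := h2 (0,1) (by simp [Dir])
      rw [hS] at h1 this
      simp at h1 this
      omega
    refine ⟨fun e => if e.2 < y then (0,-1) else (0,1), ?_, ?_⟩
    · rintro ⟨s, t⟩ he hne
      have := hE' s t he
      simp at hne ⊢
      split_ifs with h <;> refine ⟨by simp [Dir], ?_⟩ <;> rw [hS] <;> simp <;> omega
    · rintro ⟨s, t⟩ ⟨s', t'⟩ he he' hne hne' hf
      have h1 := hE' s t he
      have h2 := hE' s' t' he'
      simp at hne hne' hf ⊢
      split_ifs at hf <;> simp at hf <;> omega

lemma two_ends {S : Set (ℤ × ℤ)} (hS : IsGridSegment S) {e e' r : ℤ × ℤ} (hr : IE r S)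
    (he : IE e S) (he' : IE e' S) (h : e ≠ r) (h' : e' ≠ r) : e = e' := by
  obtain ⟨f, hf, hf'⟩ := ends_dir hS hr.1
  have h1 := hf e he h
  have h2 := hf e' he' h'
  apply hf' e e' he he' h h'
  rcases tri hS hr.1 with ⟨-, h3⟩ | ⟨-, d0, hd0, h3⟩ | ⟨h3, -⟩
  · exact absurd h1.2 (h3 _ h1.1)
  · rw [(h3 _ h1.1).1 h1.2, (h3 _ h2.1).1 h2.2]
  · exact absurd hr h3

def rot (u x : ℤ × ℤ) : ℤ × ℤ := (u.1 * x.1 - u.2 * x.2, u.2 * x.1 + u.1 * x.2)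

lemma rot_dir {u x : ℤ × ℤ} (hu : Dir u) (hx : Dir x) : Dir (rot u x) := by
  rcases hu with rfl | rfl | rfl | rfl <;> rcases hx with rfl | rfl | rfl | rfl <;> simp [rot, Dir]

lemma rot_zero (u : ℤ × ℤ) : rot u 0 = 0 := by simp [rot]

lemma rot_neg (u x : ℤ × ℤ) : rot u (-x) = - rot u x := by
  simp [rot, Prod.ext_iff]; constructor <;> ring

lemma rot_inj {u x y : ℤ × ℤ} (hu : Dir u) (h : rot u x = rot u y) : x = y := by
  rcases hu with rfl | rfl | rfl | rfl <;> simp [rot, Prod.ext_iff] at h ⊢ <;> omega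

lemma exists_rot {d d' : ℤ × ℤ} (hd : Dir d) (hd' : Dir d') : ∃ u, Dir u ∧ rot u d = d' := by
  refine ⟨(d.1*d'.1 + d.2*d'.2, d.1*d'.2 - d.2*d'.1), ?_⟩
  rcases hd with rfl | rfl | rfl | rfl <;> rcases hd' with rfl | rfl | rfl | rfl <;>
   simp [rot, Dir]

lemma exists_rot_inv {u d : ℤ × ℤ} (hu : Dir u) (hd : Dir d) : ∃ d', Dir d' ∧ rot u d' = d := by
  refine ⟨rot (u.1, -u.2) d, ?_, ?_⟩
  · apply rot_dir _ hd
    rcases hu with rfl | rfl | rfl | rfl <;> simp [Dir]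
  · rcases hu with rfl | rfl | rfl | rfl <;> simp [rot]

lemma seg_point (q : ℤ × ℤ) : IsGridSegment {q} := by
  left
  refine ⟨q.2, q.1, q.1, le_rfl, ?_⟩
  ext ⟨s, t⟩; simp [Prod.ext_iff]; omega

lemma seg_two (q : ℤ × ℤ) {d : ℤ × ℤ} (hd : Dir d) : IsGridSegment {q, q + d} := by
  rcases hd with rfl | rfl | rfl | rfl
  · left
    refine ⟨q.2, q.1, q.1+1, by omega, ?_⟩
    ext ⟨s, t⟩; simp [Prod.ext_iff]; omega
  · left
    refine ⟨q.2, q.1-1, q.1, by omega, ?_⟩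
    ext ⟨s, t⟩; simp [Prod.ext_iff]; omega
  · right
    refine ⟨q.1, q.2, q.2+1, by omega, ?_⟩
    ext ⟨s, t⟩; simp [Prod.ext_iff]; omega
  · right
    refine ⟨q.1, q.2-1, q.2, by omega, ?_⟩
    ext ⟨s, t⟩; simp [Prod.ext_iff]; omega

lemma seg_three (q : ℤ × ℤ) {d : ℤ × ℤ} (hd : Dir d) : IsGridSegment {q, q + d, q - d} := by
  rcases hd with rfl | rfl | rfl | rfl
  · left
    refine ⟨q.2, q.1-1, q.1+1, by omega, ?_⟩
    ext ⟨s, t⟩; simp [Prod.ext_iff]; omega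
  · left
    refine ⟨q.2, q.1-1, q.1+1, by omega, ?_⟩
    ext ⟨s, t⟩; simp [Prod.ext_iff]; omega
  · right
    refine ⟨q.1, q.2-1, q.2+1, by omega, ?_⟩
    ext ⟨s, t⟩; simp [Prod.ext_iff]; omega
  · right
    refine ⟨q.1, q.2-1, q.2+1, by omega, ?_⟩
    ext ⟨s, t⟩; simp [Prod.ext_iff]; omega

def star (q u r : ℤ × ℤ) (S : Set (ℤ × ℤ)) : Set (ℤ × ℤ) :=
  {x | ∃ d, (d = 0 ∨ Dir d) ∧ r + d ∈ S ∧ x = q + rot u d}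

lemma star_center {q u r : ℤ × ℤ} {S : Set (ℤ × ℤ)} (hr : r ∈ S) : q ∈ star q u r S :=
  ⟨0, Or.inl rfl, by simpa using hr, by simp [rot_zero]⟩

lemma star_dir {q u r d : ℤ × ℤ} {S : Set (ℤ × ℤ)} (hu : Dir u) (hd : Dir d) :
    q + rot u d ∈ star q u r S ↔ r + d ∈ S := by
  constructor
  · rintro ⟨d', hd', h, h'⟩
    rw [rot_inj hu (add_left_cancel h')]
    exact h
  · intro h
    exact ⟨d, Or.inr hd, h, rfl⟩

lemma star_seg {q u r : ℤ × ℤ} {S : Set (ℤ × ℤ)} (hu : Dir u) (hS : IsGridSegment S)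
    (hr : r ∈ S) : IsGridSegment (star q u r S) := by
  rcases tri hS hr with ⟨-, h⟩ | ⟨-, d0, hd0, h⟩ | ⟨-, d0, hd0, h⟩
  · convert seg_point q using 1
    ext x
    constructor
    · rintro ⟨d, rfl | hd, hd', rfl⟩
      · simp [rot_zero]
      · exact absurd hd' (h d hd)
    · rintro rfl
      exact star_center hr
  · convert seg_two q (rot_dir hu hd0) using 1
    ext x
    constructor
    · rintro ⟨d, rfl | hd, hd', rfl⟩
      · simp [rot_zero]
      · rw [(h d hd).1 hd']; simp
    · rintro (rfl | rfl)
      · exact star_center hr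
      · exact (star_dir hu hd0).2 ((h _ hd0).2 rfl)
  · convert seg_three q (rot_dir hu hd0) using 1
    ext x
    constructor
    · rintro ⟨d, rfl | hd, hd', rfl⟩
      · simp [rot_zero]
      · rcases (h d hd).1 hd' with rfl | rfl
        · simp
        · simp [rot_neg, sub_eq_add_neg]
    · rintro (rfl | rfl | rfl)
      · exact star_center hr
      · exact (star_dir hu hd0).2 ((h _ hd0).2 (Or.inl rfl))
      · rw [sub_eq_add_neg, ← rot_neg]
        exact (star_dir hu hd0.neg).2 ((h _ hd0.neg).2 (Or.inr rfl))

lemma star_IE {q u r : ℤ × ℤ} {S : Set (ℤ × ℤ)} (hu : Dir u) (hr : r ∈ S) :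
    IE q (star q u r S) ↔ IE r S := by
  unfold IE
  simp only [star_center hr, hr, true_and]
  constructor
  · rintro h d hd ⟨h1, h2⟩
    apply h _ (rot_dir hu hd)
    rw [star_dir hu hd, sub_eq_add_neg, ← rot_neg, star_dir hu hd.neg, ← sub_eq_add_neg]
    exact ⟨h1, h2⟩
  · rintro h d hd hh
    obtain ⟨d', hd', rfl⟩ := exists_rot_inv hu hd
    rw [star_dir hu hd', sub_eq_add_neg, ← rot_neg, star_dir hu hd'.neg, ← sub_eq_add_neg] at hh
    exact h d' hd' hh

lemma star_end {q u r d : ℤ × ℤ} {S : Set (ℤ × ℤ)} (hu : Dir u) (hd : Dir d) (h : r + d ∈ S) :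
    IE (q + rot u d) (star q u r S) := by
  refine ⟨(star_dir hu hd).2 h, ?_⟩
  rintro d' hd' ⟨⟨e1, he1, -, h1⟩, ⟨e2, he2, -, h2⟩⟩
  have k1 : rot u d + d' = rot u e1 := by
    rw [add_assoc] at h1; exact add_left_cancel h1
  have k2 : rot u d - d' = rot u e2 := by
    rw [add_sub_assoc] at h2; exact add_left_cancel h2
  have g1 : rot u e1 = 0 ∨ Dir (rot u e1) := he1.imp (fun h => by rw [h, rot_zero]) (rot_dir hu)
  have g2 : rot u e2 = 0 ∨ Dir (rot u e2) := he2.imp (fun h => by rw [h, rot_zero]) (rot_dir hu)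
  rw [← k1] at g1
  rw [← k2] at g2
  have g := rot_dir hu hd
  generalize rot u d = D at *
  have o1 := hd'.odd
  have o := g.odd
  rcases g1 with g1 | g1
  · rcases g2 with g2 | g2
    · apply hd'.ne
      simp only [Prod.ext_iff, Prod.fst_add, Prod.snd_add, Prod.fst_sub, Prod.snd_sub,
        Prod.fst_zero, Prod.snd_zero] at *
      omega
    · have := g2.odd
      simp only [Prod.fst_sub, Prod.snd_sub] at this
      omega
  · have := g1.odd
    simp only [Prod.fst_add, Prod.snd_add] at this
    omega

def trans (t : ℤ × ℤ) (S : Set (ℤ × ℤ)) : Set (ℤ × ℤ) := {x | x - t ∈ S}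

lemma trans_seg {t : ℤ × ℤ} {S : Set (ℤ × ℤ)} (hS : IsGridSegment S) :
    IsGridSegment (trans t S) := by
  rcases hS with ⟨c, a, b, hab, rfl⟩ | ⟨c, a, b, hab, rfl⟩
  · left
    refine ⟨c + t.2, a + t.1, b + t.1, by omega, ?_⟩
    ext ⟨x, y⟩; simp [trans]; omega
  · right
    refine ⟨c + t.1, a + t.2, b + t.2, by omega, ?_⟩
    ext ⟨x, y⟩; simp [trans]; omega

lemma trans_IE {t p : ℤ × ℤ} {S : Set (ℤ × ℤ)} : IE p (trans t S) ↔ IE (p - t) S := by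
  simp only [IE, trans, Set.mem_ofPred_eq]
  refine and_congr_right fun h => forall_congr' fun d => imp_congr_right fun hd => ?_
  rw [show p + d - t = p - t + d by abel, show p - d - t = p - t - d by abel]

lemma seg_finite {S : Set (ℤ × ℤ)} (hS : IsGridSegment S) : S.Finite := by
  rcases hS with ⟨c, a, b, hab, rfl⟩ | ⟨c, a, b, hab, rfl⟩
  · apply (Set.finite_Icc ((a, c) : ℤ × ℤ) (b, c)).subset
    rintro ⟨x, y⟩ ⟨h1, h2, h3⟩
    simp at h1 h2 h3
    simp [h1, h2, h3]
  · apply (Set.finite_Icc ((c, a) : ℤ × ℤ) (c, b)).subset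
    rintro ⟨x, y⟩ ⟨h1, h2, h3⟩
    simp at h1 h2 h3
    simp [h1, h2, h3]


lemma seg_box {S : Set (ℤ × ℤ)} (hS : IsGridSegment S) : ∃ l1 h1 l2 h2 : ℤ,
    ∀ x y : ℤ, (x, y) ∈ S ↔ l1 ≤ x ∧ x ≤ h1 ∧ l2 ≤ y ∧ y ≤ h2 := by
  rcases hS with ⟨c, a, b, hab, rfl⟩ | ⟨c, a, b, hab, rfl⟩
  · exact ⟨a, b, c, c, fun x y => by simp; omega⟩
  · exact ⟨c, c, a, b, fun x y => by simp; omega⟩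

lemma helly {S1 S2 S3 : Set (ℤ × ℤ)} (h1 : IsGridSegment S1) (h2 : IsGridSegment S2)
    (h3 : IsGridSegment S3) {r a b : ℤ × ℤ} (hs : (S1 ∩ S2).Subsingleton)
    (hr1 : r ∈ S1) (hr2 : r ∈ S2) (ha1 : a ∈ S1) (ha3 : a ∈ S3) (hb2 : b ∈ S2) (hb3 : b ∈ S3) :
    r ∈ S3 := by
  obtain ⟨r1, r2⟩ := r
  obtain ⟨a1, a2⟩ := a
  obtain ⟨b1, b2⟩ := b
  obtain ⟨_, _, _, _, k1⟩ := seg_box h1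
  obtain ⟨_, _, _, _, k2⟩ := seg_box h2
  obtain ⟨_, _, _, _, k3⟩ := seg_box h3
  have m1 : (max (min r1 a1) (min (max r1 a1) b1), max (min r2 a2) (min (max r2 a2) b2)) ∈ S1 := by
    rw [k1] at *; omega
  have m2 : (max (min r1 a1) (min (max r1 a1) b1), max (min r2 a2) (min (max r2 a2) b2)) ∈ S2 := by
    rw [k2] at *; omega
  have m3 : (max (min r1 a1) (min (max r1 a1) b1), max (min r2 a2) (min (max r2 a2) b2)) ∈ S3 := by
    rw [k3] at *; omega
  rw [hs ⟨hr1, hr2⟩ ⟨m1, m2⟩]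
  exact m3

variable {V : Type*} {G : SimpleGraph V}

def HG (G : SimpleGraph V) (S : Set V) : SimpleGraph V where
  Adj a b := G.Adj a b ∧ ¬ (a ∈ S ∧ b ∈ S)
  symm := ⟨fun _ _ h => ⟨h.1.symm, fun k => h.2 ⟨k.2, k.1⟩⟩⟩
  loopless := ⟨fun _ h => h.1.ne rfl⟩

lemma acyc (hch : Chordal G) (R : ContactB0VPGRep G) (r : ℤ × ℤ) :
    ∀ n : ℕ, ∀ x x', r ∈ R.seg x → r ∈ R.seg x' → x ≠ x' →
      (HG G {z | r ∈ R.seg z}).Reachable x x' → (HG G {z | r ∈ R.seg z}).dist x x' = n → False := by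
  intro n
  induction n using Nat.strong_induction_on with
  | _ n ih =>
  intro x x' hx hx' hne hreach hdist
  set S : Set V := {z | r ∈ R.seg z} with hS
  obtain ⟨p, hp⟩ := hreach.exists_walk_length_eq_dist
  have hpn : p.length = n := hp.trans hdist
  have hadj : ∀ y ∈ S, ∀ y' ∈ S, y ≠ y' → G.Adj y y' := by
    intro y hy y' hy' h
    exact (R.adj_iff y y' h).2 ⟨r, hy, hy'⟩
  have h0 : p.getVert 0 = x := by simp
  have hn : p.getVert n = x' := by rw [← hpn]; simp
  have hstep : ∀ i, i < n → (HG G S).Adj (p.getVert i) (p.getVert (i+1)) := by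
    intro i hi
    exact p.adj_getVert_succ (by omega)
  have hHadj : ∀ i j, i < j → j ≤ n → (HG G S).Adj (p.getVert i) (p.getVert j) → j = i + 1 := by
    intro i j hij hj h
    have := SimpleGraph.dist_le ((p.take i).append ((p.drop j).cons h))
    simp at this
    omega
  have hinj : ∀ i j, i < j → j ≤ n → p.getVert i ≠ p.getVert j := by
    intro i j hij hj h
    have := SimpleGraph.dist_le ((p.take i).append ((p.drop j).copy h.symm rfl))
    simp at this
    omega
  have hnS : ∀ i, 0 < i → i < n → p.getVert i ∉ S := by
    intro i h1 h2 h3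
    have := SimpleGraph.dist_le (p.take i)
    simp at this
    exact ih ((HG G S).dist x (p.getVert i)) (by omega) x _ hx h3
      (fun k => hinj 0 i h1 (by omega) (h0.trans k)) ⟨p.take i⟩ rfl
  have hn0 : n ≠ 0 := by
    rintro rfl
    exact hne (h0.symm.trans hn)
  have hn1 : n ≠ 1 := by
    rintro rfl
    have := hstep 0 (by omega)
    rw [h0, zero_add, hn] at this
    exact this.2 ⟨hx, hx'⟩
  have hn2 : n ≠ 2 := by
    rintro rfl
    have k1 := hstep 0 (by omega)
    have k2 := hstep 1 (by omega)
    rw [h0, zero_add] at k1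
    rw [show 1 + 1 = 2 from rfl, hn] at k2
    apply hnS 1 (by omega) (by omega)
    obtain ⟨a, ha, ha'⟩ := (R.adj_iff _ _ k1.1.ne).1 k1.1
    obtain ⟨b, hb, hb'⟩ := (R.adj_iff _ _ k2.1.ne).1 k2.1
    exact helly (R.isSeg x) (R.isSeg x') (R.isSeg _) (R.inter_subsingleton _ _ hne)
      hx hx' ha ha' hb' hb
  have hGadj : ∀ i j, i < j → j ≤ n →
      (G.Adj (p.getVert i) (p.getVert j) ↔ j = i + 1 ∨ (i = 0 ∧ j = n)) := by
    intro i j hij hj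
    constructor
    · intro h
      by_cases hh : i = 0 ∧ j = n
      · exact Or.inr hh
      · left
        apply hHadj i j hij hj
        refine ⟨h, ?_⟩
        rintro ⟨g1, g2⟩
        by_cases hi : i = 0
        · exact hnS j (by omega) (by omega) g2
        · exact hnS i (by omega) (by omega) g1
    · rintro (rfl | ⟨rfl, rfl⟩)
      · exact (hstep i (by omega)).1
      · rw [h0, hn]
        exact hadj x hx x' hx' hne
  have hcyc : ∀ i j : Fin (n+1), i < j → ((cycleGraph (n+1)).Adj i j ↔
      (j : ℕ) = i + 1 ∨ ((i : ℕ) = 0 ∧ (j : ℕ) = n)) := by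
    intro i j hij
    rw [cycleGraph_adj']
    have e1 : (j - i).val = j.val - i.val := Fin.sub_val_of_le hij.le
    have e2 : (i - j).val = n + 1 - j.val + i.val := by
      rw [Fin.val_sub]
      apply Nat.mod_eq_of_lt
      have := Fin.lt_def.1 hij
      omega
    rw [e1, e2]
    have := Fin.lt_def.1 hij
    omega
  apply (hch (n+1) (by omega)).false
  refine ⟨⟨fun i => p.getVert i, ?_⟩, ?_⟩
  · intro i j h
    rcases lt_trichotomy i j with k | k | k
    · exact absurd h (hinj i j k (by omega))
    · exact k
    · exact absurd h.symm (hinj j i k (by omega))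
  · intro i j
    change G.Adj (p.getVert i) (p.getVert j) ↔ _
    rcases lt_trichotomy i j with k | k | k
    · rw [hGadj i j k (by omega), hcyc i j k]
    · subst k; simp
    · rw [G.adj_comm, SimpleGraph.adj_comm (cycleGraph (n+1)), hGadj j i k (by omega), hcyc j i k]

lemma acyc' (hch : Chordal G) (R : ContactB0VPGRep G) {r : ℤ × ℤ} {x x' : V}
    (hx : r ∈ R.seg x) (hx' : r ∈ R.seg x') (h : (HG G {z | r ∈ R.seg z}).Reachable x x') :
    x = x' := by
  by_contra hne
  exact acyc hch R r _ x x' hx hx' hne h rfl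


def KA (G : SimpleGraph V) (A : Set V) : SimpleGraph V where
  Adj a b := G.Adj a b ∧ a ∈ A ∧ b ∈ A
  symm := ⟨fun _ _ h => ⟨h.1.symm, h.2.2, h.2.1⟩⟩
  loopless := ⟨fun _ h => h.1.ne rfl⟩

def PP (G : SimpleGraph V) (T : V → Set (ℤ × ℤ)) (a b : V) : Prop :=
  (G.Adj a b ↔ (T a ∩ T b).Nonempty) ∧ (T a ∩ T b).Subsingleton ∧
    ∀ p, p ∈ T a → p ∈ T b → IE p (T a) ∨ IE p (T b)

lemma PP.symm {T : V → Set (ℤ × ℤ)} {a b : V} (h : PP G T a b) : PP G T b a := by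
  obtain ⟨h1, h2, h3⟩ := h
  refine ⟨?_, ?_, ?_⟩
  · rw [G.adj_comm, Set.inter_comm]; exact h1
  · rw [Set.inter_comm]; exact h2
  · intro p hp hp'
    exact (h3 p hp' hp).symm

lemma rep_PP (R : ContactB0VPGRep G) {a b : V} (h : a ≠ b) : PP G R.seg a b := by
  refine ⟨R.adj_iff a b h, R.inter_subsingleton a b h, fun p h1 h2 => ?_⟩
  rw [← endpoint_iff (R.isSeg a), ← endpoint_iff (R.isSeg b)]
  exact R.contact a b h p ⟨h1, h2⟩

lemma PP_congr {T T' : V → Set (ℤ × ℤ)} {a b : V} (ha : T' a = T a) (hb : T' b = T b)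
    (h : PP G T a b) : PP G T' a b := by
  unfold PP at *
  rw [ha, hb]; exact h

structure PRep (G : SimpleGraph V) (A : Set V) (T : V → Set (ℤ × ℤ)) : Prop where
  seg : ∀ a ∈ A, IsGridSegment (T a)
  pp : ∀ a ∈ A, ∀ b ∈ A, a ≠ b → PP G T a b

def EE (Rf : V → ContactB0VPGRep G) (A : Set V) (y : V) : Set (ℤ × ℤ) :=
  {e | IE e ((Rf y).seg y) ∧ ∃ z, z ∉ A ∧ e ∈ (Rf y).seg z}

structure GInv (Rf : V → ContactB0VPGRep G) (v : V) (A : Set V) (T : V → Set (ℤ × ℤ))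
    (f : V → ℤ × ℤ → ℤ × ℤ) (g : ℤ × ℤ) : Prop where
  prep : PRep G A T
  vA : v ∈ A
  nt : ∀ y ∈ A, ∀ z, z ∉ A → G.Adj y z → ((Rf y).seg y).Nontrivial ∧ (T y).Nontrivial
  ffree : ∀ y ∈ A, ∀ e ∈ EE Rf A y, IE (f y e) (T y) ∧ ∀ b ∈ A, b ≠ y → f y e ∉ T b
  finj : ∀ y ∈ A, ∀ e ∈ EE Rf A y, ∀ e' ∈ EE Rf A y, f y e = f y e' → e = e'
  gfree : IE g (T v) ∧ ∀ b ∈ A, b ≠ v → g ∉ T b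
  fg : ∀ e ∈ EE Rf A v, f v e ≠ g

lemma add_self_inj {a b : ℤ × ℤ} (h : a + a = b + b) : a = b := by
  simp only [Prod.ext_iff, Prod.fst_add, Prod.snd_add] at h ⊢
  omega

lemma dbl_ginv {Rf : V → ContactB0VPGRep G} {v : V} {A : Set V} {T : V → Set (ℤ × ℤ)}
    {f : V → ℤ × ℤ → ℤ × ℤ} {g : ℤ × ℤ} (h : GInv Rf v A T f g) :
    GInv Rf v A (fun a => dbl (T a)) (fun y e => f y e + f y e) (g + g) where
  prep := by
    refine ⟨fun a ha => dbl_seg (h.prep.seg a ha), fun a ha b hb hab => ?_⟩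
    obtain ⟨h1, h2, h3⟩ := h.prep.pp a ha b hb hab
    refine ⟨?_, ?_, ?_⟩
    · rw [h1]
      constructor
      · rintro ⟨x, hx, hx'⟩
        exact ⟨x + x, even_mem_dbl.2 hx, even_mem_dbl.2 hx'⟩
      · rintro ⟨x, hx, hx'⟩
        obtain ⟨m, hm, hm', -⟩ := dbl_inter h2 hx hx'
        exact ⟨m, hm, hm'⟩
    · rintro x ⟨hx, hx'⟩ z ⟨hz, hz'⟩
      obtain ⟨m, hm, hm', rfl⟩ := dbl_inter h2 hx hx'
      obtain ⟨n, hn, hn', rfl⟩ := dbl_inter h2 hz hz'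
      rw [h2 ⟨hm, hm'⟩ ⟨hn, hn'⟩]
    · rintro x hx hx'
      obtain ⟨m, hm, hm', rfl⟩ := dbl_inter h2 hx hx'
      rw [dbl_IE, dbl_IE]
      exact h3 m hm hm'
  vA := h.vA
  nt := by
    intro y hy z hz hyz
    obtain ⟨h1, a, ha, b, hb, hab⟩ := h.nt y hy z hz hyz
    exact ⟨h1, a + a, even_mem_dbl.2 ha, b + b, even_mem_dbl.2 hb, fun k => hab (add_self_inj k)⟩
  ffree := by
    intro y hy e he
    refine ⟨dbl_IE.2 (h.ffree y hy e he).1, fun b hb hby => ?_⟩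
    rw [even_mem_dbl]
    exact (h.ffree y hy e he).2 b hb hby
  finj := fun y hy e he e' he' k => h.finj y hy e he e' he' (add_self_inj k)
  gfree := by
    refine ⟨dbl_IE.2 h.gfree.1, fun b hb hby => ?_⟩
    rw [even_mem_dbl]
    exact h.gfree.2 b hb hby
  fg := fun e he k => h.fg e he (add_self_inj k)

lemma step_ginv {Rf : V → ContactB0VPGRep G} {v : V} {A : Set V} {T : V → Set (ℤ × ℤ)}
    {f : V → ℤ × ℤ → ℤ × ℤ} {g : ℤ × ℤ} (h : GInv Rf v A T f g)
    {y : V} (hy : y ∈ A) {q : ℤ × ℤ} (hq : q ∈ T y)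
    (near : ∀ a ∈ A, ∀ d, (d = 0 ∨ Dir d) → q + d ∈ T a → a = y)
    {u r : ℤ × ℤ} (hu : Dir u) (hr : r ∈ (Rf y).seg y)
    (hm : ∀ d, Dir d → (r + d ∈ (Rf y).seg y ↔ q + rot u d ∈ T y))
    (hfq : ∀ e ∈ EE Rf A y, e ≠ r → f y e ≠ q) (hgq : y = v → g ≠ q)
    (hRf : ∀ z, z ∉ A → r ∈ (Rf y).seg z → Rf z = Rf y)
    (hI1 : ∀ z, z ∉ A → ∀ a ∈ A, ∀ b ∈ A, G.Adj a z → G.Adj b z → a = b) :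
    ∃ T' f', GInv Rf v (A ∪ {z | r ∈ (Rf y).seg z}) T' f' g := by
  classical
  have hnear0 : ∀ a ∈ A, q ∈ T a → a = y := fun a ha hh => near a ha 0 (Or.inl rfl) (by simpa using hh)
  have hIEq : IE r ((Rf y).seg y) → IE q (T y) := by
    rintro ⟨-, k⟩
    refine ⟨hq, ?_⟩
    rintro d hd hh
    obtain ⟨d', hd', rfl⟩ := exists_rot_inv hu hd
    apply k d' hd'
    rw [hm d' hd', sub_eq_add_neg, hm _ hd'.neg, rot_neg, ← sub_eq_add_neg]
    exact hh
  have hdisj : ∀ a b, a ≠ b → r ∈ (Rf y).seg a → r ∈ (Rf y).seg b → ∀ d, Dir d →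
      r + d ∈ (Rf y).seg a → r + d ∈ (Rf y).seg b → False := by
    intro a b hab h1 h2 d hd h3 h4
    have := (Rf y).inter_subsingleton a b hab ⟨h1, h2⟩ ⟨h3, h4⟩
    exact hd.ne (by simpa using this.symm)
  have hpos : ∀ z, ∃ h : ℤ × ℤ → ℤ × ℤ, r ∈ (Rf y).seg z →
      (∀ e, IE e ((Rf y).seg z) → e ≠ r → Dir (h e) ∧ r + h e ∈ (Rf y).seg z) ∧
      (∀ e e', IE e ((Rf y).seg z) → IE e' ((Rf y).seg z) → e ≠ r → e' ≠ r → h e = h e' → e = e') := by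
    intro z
    by_cases hz : r ∈ (Rf y).seg z
    · obtain ⟨k, hk⟩ := ends_dir ((Rf y).isSeg z) hz
      exact ⟨k, fun _ => hk⟩
    · exact ⟨id, fun k => absurd k hz⟩
  choose h' hh' using hpos
  set T' : V → Set (ℤ × ℤ) := fun a => if a ∈ A then T a else star q u r ((Rf y).seg a) with hT'
  have TA : ∀ a ∈ A, T' a = T a := fun a ha => by simp [hT', ha]
  have TN : ∀ a, a ∉ A → T' a = star q u r ((Rf y).seg a) := fun a ha => by simp [hT', ha]
  -- points of new segments
  have hAN : ∀ a ∈ A, ∀ b, b ∉ A → r ∈ (Rf y).seg b → ∀ x, x ∈ T a →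
      x ∈ star q u r ((Rf y).seg b) → x = q ∧ a = y := by
    rintro a ha b hb hrb x hx ⟨d, hd, hd', rfl⟩
    have hay : a = y := by
      apply near a ha (rot u d) _ hx
      exact hd.imp (fun k => by rw [k, rot_zero]) (rot_dir hu)
    refine ⟨?_, hay⟩
    subst hay
    rcases hd with rfl | hd
    · simp [rot_zero]
    · exact (hdisj a b (fun k => hb (k ▸ ha)) hr hrb d hd ((hm d hd).2 hx) hd').elim
  have hNN : ∀ a b, a ≠ b → r ∈ (Rf y).seg a → r ∈ (Rf y).seg b → ∀ x,
      x ∈ star q u r ((Rf y).seg a) → x ∈ star q u r ((Rf y).seg b) → x = q := by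
    rintro a b hab hra hrb x ⟨d, hd, hd', rfl⟩ ⟨e, he, he', k⟩
    have : d = e := rot_inj hu (add_left_cancel k)
    subst this
    rcases hd with rfl | hd
    · simp [rot_zero]
    · exact (hdisj a b hab hra hrb d hd hd' he').elim
  have hadjB : ∀ a b, a ≠ b → r ∈ (Rf y).seg a → r ∈ (Rf y).seg b → G.Adj a b := fun a b hab h1 h2 =>
    ((Rf y).adj_iff a b hab).2 ⟨r, h1, h2⟩
  have hPP : ∀ a ∈ A ∪ {z | r ∈ (Rf y).seg z}, ∀ b ∈ A ∪ {z | r ∈ (Rf y).seg z}, b ∉ A → a ≠ b →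
      PP G T' a b := by
    intro a ha b hb hbA hab
    have hrb : r ∈ (Rf y).seg b := hb.resolve_left hbA
    by_cases haA : a ∈ A
    · unfold PP
      rw [TA a haA, TN b hbA]
      have key := hAN a haA b hbA hrb
      have hyb : y ≠ b := fun k => hbA (k ▸ hy)
      refine ⟨?_, ?_, ?_⟩
      · constructor
        · intro hadj
          have : a = y := hI1 b hbA a haA y hy hadj (hadjB y b hyb hr hrb)
          subst this
          exact ⟨q, hq, star_center hrb⟩
        · rintro ⟨x, hx, hx'⟩
          obtain ⟨-, rfl⟩ := key x hx hx'
          exact hadjB a b hab hr hrb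
      · rintro x ⟨hx, hx'⟩ z ⟨hz, hz'⟩
        rw [(key x hx hx').1, (key z hz hz').1]
      · intro x hx hx'
        obtain ⟨rfl, rfl⟩ := key x hx hx'
        rw [star_IE hu hrb]
        exact ((rep_PP (Rf a) hab).2.2 r hr hrb).imp hIEq id
    · have hra : r ∈ (Rf y).seg a := ha.resolve_left haA
      unfold PP
      rw [TN a haA, TN b hbA]
      have key := hNN a b hab hra hrb
      refine ⟨?_, ?_, ?_⟩
      · exact ⟨fun _ => ⟨q, star_center hra, star_center hrb⟩, fun _ => hadjB a b hab hra hrb⟩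
      · rintro x ⟨hx, hx'⟩ z ⟨hz, hz'⟩
        rw [key x hx hx', key z hz hz']
      · intro x hx hx'
        obtain rfl := key x hx hx'
        rw [star_IE hu hrb, star_IE hu hra]
        exact ((rep_PP (Rf y) hab).2.2 r hra hrb)
  have hEEr : ∀ a, r ∈ (Rf y).seg a → Rf a = Rf y → ∀ e ∈ EE Rf (A ∪ {z | r ∈ (Rf y).seg z}) a, e ≠ r := by
    rintro a hra hRa e ⟨-, z, hz, hz'⟩ rfl
    rw [hRa] at hz'
    exact hz (Or.inr hz')
  have hEEA : ∀ a, ∀ e ∈ EE Rf (A ∪ {z | r ∈ (Rf y).seg z}) a, e ∈ EE Rf A a := by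
    rintro a e ⟨h1, z, hz, hz'⟩
    exact ⟨h1, z, fun k => hz (Or.inl k), hz'⟩
  -- old free points stay free
  have hold : ∀ a ∈ A, ∀ x, x ∈ T a → x ≠ q → (∀ b ∈ A, b ≠ a → x ∉ T b) →
      ∀ b ∈ A ∪ {z | r ∈ (Rf y).seg z}, b ≠ a → x ∉ T' b := by
    intro a ha x hx hxq k b hb hba
    by_cases hbA : b ∈ A
    · rw [TA b hbA]; exact k b hbA hba
    · rw [TN b hbA]
      intro hx'
      exact hxq (hAN a ha b hbA (hb.resolve_left hbA) x hx hx').1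
  have hfq' : ∀ a ∈ A, ∀ e ∈ EE Rf (A ∪ {z | r ∈ (Rf y).seg z}) a, f a e ≠ q := by
    intro a ha e he
    by_cases hay : a = y
    · subst hay
      exact hfq e (hEEA a e he) (hEEr a hr rfl e he)
    · intro k
      apply hay
      apply hnear0 a ha
      rw [← k]
      exact (h.ffree a ha e (hEEA a e he)).1.1
  refine ⟨T', fun a e => if a ∈ A then f a e else q + rot u (h' a e), ?_⟩
  constructor
  · constructor
    · intro a ha
      by_cases haA : a ∈ A
      · rw [TA a haA]; exact h.prep.seg a haA
      · rw [TN a haA]; exact star_seg hu ((Rf y).isSeg a) (ha.resolve_left haA)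
    · intro a ha b hb hab
      by_cases hbA : b ∈ A
      · by_cases haA : a ∈ A
        · exact PP_congr (TA a haA) (TA b hbA) (h.prep.pp a haA b hbA hab)
        · exact (hPP b hb a ha haA hab.symm).symm
      · exact hPP a ha b hb hbA hab
  · exact Or.inl h.vA
  · intro a ha z hz haz
    by_cases haA : a ∈ A
    · rw [TA a haA]
      exact h.nt a haA z (fun k => hz (Or.inl k)) haz
    · have hra : r ∈ (Rf y).seg a := ha.resolve_left haA
      rw [hRf a haA hra, TN a haA]
      obtain ⟨x, hx, hx'⟩ := ((Rf y).adj_iff a z haz.ne).1 haz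
      have hxr : x ≠ r := by
        rintro rfl
        exact hz (Or.inr hx')
      refine ⟨⟨x, hx, r, hra, hxr⟩, ?_⟩
      have : ∃ d, Dir d ∧ r + d ∈ (Rf y).seg a := by
        rcases tri ((Rf y).isSeg a) hra with ⟨k, -⟩ | ⟨-, d0, hd0, k⟩ | ⟨-, d0, hd0, k⟩
        · rw [k] at hx; exact absurd hx hxr
        · exact ⟨d0, hd0, (k d0 hd0).2 rfl⟩
        · exact ⟨d0, hd0, (k d0 hd0).2 (Or.inl rfl)⟩
      obtain ⟨d, hd, hd'⟩ := this
      refine ⟨q, star_center hra, q + rot u d, (star_dir hu hd).2 hd', ?_⟩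
      intro k
      exact (rot_dir hu hd).ne (by simpa using k.symm)
  · intro a ha e he
    by_cases haA : a ∈ A
    · simp only [haA, if_true, TA a haA]
      have k := h.ffree a haA e (hEEA a e he)
      exact ⟨k.1, hold a haA _ k.1.1 (hfq' a haA e he) k.2⟩
    · have hra : r ∈ (Rf y).seg a := ha.resolve_left haA
      simp only [haA, if_false, TN a haA]
      have hRa := hRf a haA hra
      have hIE : IE e ((Rf y).seg a) := by have := he.1; rwa [hRa] at this
      obtain ⟨k1, k2⟩ := (hh' a hra).1 e hIE (hEEr a hra hRa e he)
      refine ⟨star_end hu k1 k2, ?_⟩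
      have hneq : q + rot u (h' a e) ≠ q := fun k => (rot_dir hu k1).ne (by simpa using k)
      intro b hb hba
      by_cases hbA : b ∈ A
      · rw [TA b hbA]
        intro hx
        exact hneq (hAN b hbA a haA hra _ hx ((star_dir hu k1).2 k2)).1
      · rw [TN b hbA]
        intro hx
        exact hneq (hNN b a hba (hb.resolve_left hbA) hra _ hx ((star_dir hu k1).2 k2))
  · intro a ha e he e' he' k
    by_cases haA : a ∈ A
    · simp only [haA, if_true] at k
      exact h.finj a haA e (hEEA a e he) e' (hEEA a e' he') k
    · have hra : r ∈ (Rf y).seg a := ha.resolve_left haA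
      simp only [haA, if_false] at k
      have hRa := hRf a haA hra
      have hIE : IE e ((Rf y).seg a) := by have := he.1; rwa [hRa] at this
      have hIE' : IE e' ((Rf y).seg a) := by have := he'.1; rwa [hRa] at this
      exact (hh' a hra).2 e e' hIE hIE' (hEEr a hra hRa e he) (hEEr a hra hRa e' he')
        (rot_inj hu (add_left_cancel k))
  · rw [TA v h.vA]
    refine ⟨h.gfree.1, hold v h.vA g h.gfree.1.1 ?_ h.gfree.2⟩
    rintro rfl
    have := hnear0 v h.vA h.gfree.1.1
    exact hgq this.symm rfl
  · intro e he
    simp only [h.vA, if_true]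
    exact h.fg e (hEEA v e he)


lemma step2 {Rf : V → ContactB0VPGRep G} {v : V} {A : Set V} {T : V → Set (ℤ × ℤ)}
    {f : V → ℤ × ℤ → ℤ × ℤ} {g : ℤ × ℤ} (h : GInv Rf v A T f g)
    {y : V} (hy : y ∈ A) {q : ℤ × ℤ} (hq : q ∈ T y)
    (near : ∀ a ∈ A, q ∈ T a → a = y)
    {u r : ℤ × ℤ} (hu : Dir u) (hr : r ∈ (Rf y).seg y)
    (hm : ∀ d, Dir d → (r + d ∈ (Rf y).seg y ↔ q + rot u d ∈ T y))
    (hfq : ∀ e ∈ EE Rf A y, e ≠ r → f y e ≠ q) (hgq : y = v → g ≠ q)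
    (hRf : ∀ z, z ∉ A → r ∈ (Rf y).seg z → Rf z = Rf y)
    (hI1 : ∀ z, z ∉ A → ∀ a ∈ A, ∀ b ∈ A, G.Adj a z → G.Adj b z → a = b) :
    ∃ T' f' g', GInv Rf v (A ∪ {z | r ∈ (Rf y).seg z}) T' f' g' := by
  obtain ⟨T', f', k⟩ := step_ginv (dbl_ginv h) hy (q := q + q) (even_mem_dbl.2 hq)
    (by
      rintro a ha d (rfl | hd) hh
      · rw [add_zero] at hh
        exact near a ha (even_mem_dbl.1 hh)
      · exact near a ha ((odd_mem_dbl hd).1 hh).1) hu hr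
    (by
      intro d hd
      rw [odd_mem_dbl (rot_dir hu hd), hm d hd]
      simp [hq])
    (fun e he her k => hfq e he her (add_self_inj k))
    (fun hyv k => hgq hyv (add_self_inj k)) hRf hI1
  exact ⟨T', f', _, k⟩

lemma step3 {Rf : V → ContactB0VPGRep G} {v : V} {A : Set V} {T : V → Set (ℤ × ℤ)}
    {f : V → ℤ × ℤ → ℤ × ℤ} {g : ℤ × ℤ} (h : GInv Rf v A T f g)
    {y z : V} (hy : y ∈ A) (hz : z ∉ A) {r : ℤ × ℤ} (hr : r ∈ (Rf y).seg y)
    (hrz : r ∈ (Rf y).seg z)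
    (hRf : ∀ z, z ∉ A → r ∈ (Rf y).seg z → Rf z = Rf y)
    (hI1 : ∀ z, z ∉ A → ∀ a ∈ A, ∀ b ∈ A, G.Adj a z → G.Adj b z → a = b) :
    ∃ T' f' g', GInv Rf v (A ∪ {z | r ∈ (Rf y).seg z}) T' f' g' := by
  have hadj : G.Adj y z := ((Rf y).adj_iff y z (fun k => hz (k ▸ hy))).2 ⟨r, hr, hrz⟩
  obtain ⟨nt1, nt2⟩ := h.nt y hy z hz hadj
  rcases tri ((Rf y).isSeg y) hr with ⟨k, -⟩ | ⟨k, d0, hd0, hd⟩ | ⟨k, d0, hd0, hd⟩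
  · rw [k] at nt1
    exact absurd nt1 Set.not_nontrivial_singleton
  · have hrE : r ∈ EE Rf A y := ⟨k, z, hz, hrz⟩
    obtain ⟨f1, f2⟩ := h.ffree y hy r hrE
    rcases tri (h.prep.seg y hy) f1.1 with ⟨k', -⟩ | ⟨-, d1, hd1, hd'⟩ | ⟨k', -⟩
    · rw [k'] at nt2
      exact absurd nt2 Set.not_nontrivial_singleton
    · obtain ⟨u, hu, hud⟩ := exists_rot hd0 hd1
      refine step2 h hy f1.1 ?_ hu hr ?_ ?_ ?_ hRf hI1
      · intro a ha hh
        by_contra hay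
        exact f2 a ha hay hh
      · intro d hdd
        rw [hd d hdd, hd' _ (rot_dir hu hdd), ← hud]
        exact ⟨fun k => by rw [k], fun k => rot_inj hu k⟩
      · intro e he her k
        exact her (h.finj y hy e he r hrE k)
      · rintro rfl k
        exact h.fg r hrE k.symm
    · exact absurd f1 k'
  · obtain ⟨m, hmT, n, hnT, hmn⟩ := nt2
    have : ∃ d1, Dir d1 ∧ m + d1 ∈ T y := by
      rcases tri (h.prep.seg y hy) hmT with ⟨k', -⟩ | ⟨-, d1, hd1, hd'⟩ | ⟨-, d1, hd1, hd'⟩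
      · rw [k'] at hnT
        exact absurd hnT.symm hmn
      · exact ⟨d1, hd1, (hd' d1 hd1).2 rfl⟩
      · exact ⟨d1, hd1, (hd' d1 hd1).2 (Or.inl rfl)⟩
    obtain ⟨d1, hd1, hm1⟩ := this
    have hq : m + m + d1 ∈ dbl (T y) := (odd_mem_dbl hd1).2 ⟨hmT, hm1⟩
    have hnE : ¬ IE (m + m + d1) (dbl (T y)) := by
      rintro ⟨-, k'⟩
      apply k' d1 hd1
      rw [show m + m + d1 + d1 = (m + d1) + (m + d1) by abel, show m + m + d1 - d1 = m + m by abel,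
        even_mem_dbl, even_mem_dbl]
      exact ⟨hm1, hmT⟩
    have H := dbl_ginv h
    rcases tri (dbl_seg (h.prep.seg y hy)) hq with ⟨k', -⟩ | ⟨k', -⟩ | ⟨-, d2, hd2, hd'⟩
    · have := (even_mem_dbl (m := m)).2 hmT
      rw [k'] at this
      exact absurd (by simpa using this) hd1.ne
    · exact absurd k' hnE
    · obtain ⟨u, hu, hud⟩ := exists_rot hd0 hd2
      refine step2 H hy hq ?_ hu hr ?_ ?_ ?_ hRf hI1
      · intro a ha hh
        by_contra hay
        have k1 := (odd_mem_dbl hd1).1 hh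
        have := (h.prep.pp a ha y hy hay).2.1 ⟨k1.1, hmT⟩ ⟨k1.2, hm1⟩
        exact hd1.ne (by simpa using this)
      · intro d hdd
        rw [hd d hdd, hd' _ (rot_dir hu hdd), ← hud, ← rot_neg]
        exact or_congr ⟨fun k => by rw [k], fun k => rot_inj hu k⟩
          ⟨fun k => by rw [k], fun k => rot_inj hu k⟩
      · intro e he her k
        have := (H.ffree y hy e he).1
        rw [k] at this
        exact hnE this
      · rintro rfl k
        have := H.gfree.1
        rw [k] at this
        exact hnE this

structure AInv (G : SimpleGraph V) (S A : Set V) : Prop where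
  SA : S ⊆ A
  I1 : ∀ z, z ∉ A → ∀ a ∈ A, ∀ b ∈ A, G.Adj a z → G.Adj b z → a = b
  I2 : ∀ a ∈ A, ∀ b ∈ A, (KA G A).Reachable a b

lemma step_ainv (hch : Chordal G) (R : ContactB0VPGRep G) {S A : Set V} (h : AInv G S A)
    {y z : V} (hy : y ∈ A) (hz : z ∉ A) {r : ℤ × ℤ} (hr : r ∈ R.seg y) (hrz : r ∈ R.seg z) :
    AInv G S (A ∪ {z | r ∈ R.seg z}) := by
  set B : Set V := {z | r ∈ R.seg z} with hB
  have hadj : ∀ a b, a ≠ b → r ∈ R.seg a → r ∈ R.seg b → G.Adj a b := fun a b hab h1 h2 =>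
    (R.adj_iff a b hab).2 ⟨r, h1, h2⟩
  have hyz : y ≠ z := fun k => hz (k ▸ hy)
  have hBA : ∀ a ∈ A, r ∈ R.seg a → a = y := by
    intro a ha hra
    exact h.I1 z hz a ha y hy (hadj a z (fun k => hz (k ▸ ha)) hra hrz) (hadj y z hyz hr hrz)
  have hle : KA G A ≤ HG G B := by
    rintro a b ⟨h1, h2, h3⟩
    refine ⟨h1, fun k => h1.ne ?_⟩
    rw [hBA a h2 k.1, hBA b h3 k.2]
  have hle2 : KA G A ≤ KA G (A ∪ B) := fun a b ⟨h1, h2, h3⟩ => ⟨h1, Or.inl h2, Or.inl h3⟩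
  have hmix : ∀ w, w ∉ A ∪ B → ∀ a ∈ A, ∀ b ∈ B, G.Adj a w → G.Adj b w → a = b := by
    intro w hw a ha b hb haw hbw
    have hwB : w ∉ B := fun k => hw (Or.inr k)
    have h1 : (HG G B).Reachable y a := (h.I2 y hy a ha).mono hle
    have h2 : (HG G B).Adj a w := ⟨haw, fun k => hwB k.2⟩
    have h3 : (HG G B).Adj w b := ⟨hbw.symm, fun k => hwB k.1⟩
    have hyb : y = b := acyc' hch R hr hb ((h1.trans h2.reachable).trans h3.reachable)
    subst hyb
    exact h.I1 w (fun k => hw (Or.inl k)) a ha y hy haw hbw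
  refine ⟨fun x hx => Or.inl (h.SA hx), ?_, ?_⟩
  · intro w hw a ha b hb haw hbw
    have hwB : w ∉ B := fun k => hw (Or.inr k)
    rcases ha with ha | ha
    · rcases hb with hb | hb
      · exact h.I1 w (fun k => hw (Or.inl k)) a ha b hb haw hbw
      · exact hmix w hw a ha b hb haw hbw
    · rcases hb with hb | hb
      · exact (hmix w hw b hb a ha hbw haw).symm
      · have h2 : (HG G B).Adj a w := ⟨haw, fun k => hwB k.2⟩
        have h3 : (HG G B).Adj w b := ⟨hbw.symm, fun k => hwB k.1⟩
        exact acyc' hch R ha hb (h2.reachable.trans h3.reachable)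
  · have key : ∀ a ∈ A ∪ B, (KA G (A ∪ B)).Reachable y a := by
      rintro a (ha | ha)
      · exact (h.I2 y hy a ha).mono hle2
      · by_cases hya : y = a
        · rw [hya]
        · exact SimpleGraph.Adj.reachable ⟨hadj y a hya hr ha, Or.inl hy, Or.inr ha⟩
    intro a ha b hb
    exact (key a ha).symm.trans (key b hb)

lemma grow [Finite V] (hch : Chordal G) {S : Set V} {Rf : V → ContactB0VPGRep G} {v : V}
    (hRf : ∀ a b, (HG G S).Adj a b → Rf a = Rf b) :
    ∀ n : ℕ, ∀ A T f g, AInv G S A → GInv Rf v A T f g → Aᶜ.ncard = n →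
      ∃ A T f g, AInv G S A ∧ GInv Rf v A T f g ∧ ∀ a ∈ A, ∀ b, b ∉ A → ¬ G.Adj a b := by
  intro n
  induction n using Nat.strong_induction_on with
  | _ n ih =>
  intro A T f g hA hG hn
  by_cases hcl : ∀ a ∈ A, ∀ b, b ∉ A → ¬ G.Adj a b
  · exact ⟨A, T, f, g, hA, hG, hcl⟩
  · push Not at hcl
    obtain ⟨y, hy, z, hz, hyz⟩ := hcl
    obtain ⟨r, hr, hrz⟩ := ((Rf y).adj_iff y z hyz.ne).1 hyz
    have hA' := step_ainv hch (Rf y) hA hy hz hr hrz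
    obtain ⟨T', f', g', hG'⟩ := step3 hG hy hz hr hrz
      (by
        intro w hw hrw
        have hwy : w ≠ y := fun k => hw (k ▸ hy)
        apply hRf
        refine ⟨((Rf y).adj_iff w y hwy).2 ⟨r, hrw, hr⟩, fun k => hw (hA.SA k.1)⟩) hA.I1
    refine ih _ ?_ _ T' f' g' hA' hG' rfl
    rw [← hn]
    apply Set.ncard_lt_ncard _ (Set.toFinite _)
    rw [Set.ssubset_iff_of_subset (Set.compl_subset_compl.2 Set.subset_union_left)]
    exact ⟨z, hz, fun k => k (Or.inr hrz)⟩

lemma finish [Finite V] (R : ContactB0VPGRep G) {v : V} {A : Set V} {T : V → Set (ℤ × ℤ)}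
    {g : ℤ × ℤ} (hT : PRep G A T) (hv : v ∈ A) (hg : IE g (T v) ∧ ∀ b ∈ A, b ≠ v → g ∉ T b)
    (hcl : ∀ a ∈ A, ∀ b, b ∉ A → ¬ G.Adj a b) : ¬ InternalVertex G v := by
  classical
  set F1 : Set (ℤ × ℤ) := ⋃ a ∈ A, T a with hF1
  set F2 : Set (ℤ × ℤ) := ⋃ a, R.seg a with hF2
  have f1 : F1.Finite := Set.Finite.biUnion (Set.toFinite A) fun a ha => seg_finite (hT.seg a ha)
  have f2 : F2.Finite := Set.finite_iUnion fun a => seg_finite (R.isSeg a)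
  obtain ⟨t, ht⟩ := (Set.Finite.image2 (fun x y => x - y) f1 f2).exists_notMem
  have hdis : ∀ a ∈ A, ∀ b, ∀ x, x ∈ T a → x ∉ trans t (R.seg b) := by
    intro a ha b x hx hx'
    apply ht
    refine ⟨x, Set.mem_biUnion ha hx, x - t, Set.mem_iUnion.2 ⟨b, hx'⟩, by simp⟩
  set T' : V → Set (ℤ × ℤ) := fun a => if a ∈ A then T a else trans t (R.seg a) with hT'
  have TA : ∀ a ∈ A, T' a = T a := fun a ha => by simp [hT', ha]
  have TN : ∀ a, a ∉ A → T' a = trans t (R.seg a) := fun a ha => by simp [hT', ha]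
  have hseg : ∀ a, IsGridSegment (T' a) := by
    intro a
    by_cases ha : a ∈ A
    · rw [TA a ha]; exact hT.seg a ha
    · rw [TN a ha]; exact trans_seg (R.isSeg a)
  have hmix : ∀ a ∈ A, ∀ b, b ∉ A → PP G T' a b := by
    intro a ha b hb
    unfold PP
    rw [TA a ha, TN b hb]
    have : T a ∩ trans t (R.seg b) = ∅ := by
      ext x
      simp only [Set.mem_inter_iff, Set.mem_empty_iff_false, iff_false, not_and]
      exact hdis a ha b x
    rw [this]
    refine ⟨by simpa using hcl a ha b hb, Set.subsingleton_empty, ?_⟩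
    intro p hp hp'
    exact absurd hp' (hdis a ha b p hp)
  have hPP : ∀ a b, a ≠ b → PP G T' a b := by
    intro a b hab
    by_cases ha : a ∈ A
    · by_cases hb : b ∈ A
      · exact PP_congr (TA a ha) (TA b hb) (hT.pp a ha b hb hab)
      · exact hmix a ha b hb
    · by_cases hb : b ∈ A
      · exact (hmix b hb a ha).symm
      · obtain ⟨h1, h2, h3⟩ := rep_PP R hab
        unfold PP
        rw [TN a ha, TN b hb]
        refine ⟨?_, ?_, ?_⟩
        · rw [h1]
          constructor
          · rintro ⟨x, hx, hx'⟩
            exact ⟨x + t, by simpa [trans] using hx, by simpa [trans] using hx'⟩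
          · rintro ⟨x, hx, hx'⟩
            exact ⟨x - t, hx, hx'⟩
        · rintro x ⟨hx, hx'⟩ y ⟨hy, hy'⟩
          exact sub_left_injective (h2 ⟨hx, hx'⟩ ⟨hy, hy'⟩)
        · intro p hp hp'
          rw [trans_IE, trans_IE]
          exact h3 _ hp hp'
  intro hint
  let R' : ContactB0VPGRep G :=
    { seg := T'
      isSeg := hseg
      adj_iff := fun a b hab => (hPP a b hab).1
      inter_subsingleton := fun a b hab => (hPP a b hab).2.1
      contact := fun a b hab p hp => by
        rw [endpoint_iff (hseg a), endpoint_iff (hseg b)]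
        exact (hPP a b hab).2.2 p hp.1 hp.2 }
  apply hint R'
  refine ⟨g, ?_, ?_⟩
  · change IsEndpointOf g (T' v)
    rw [endpoint_iff (hseg v), TA v hv]
    exact hg.1
  · intro w hw
    change g ∉ T' w
    by_cases hwA : w ∈ A
    · rw [TA w hwA]; exact hg.2 w hwA hw
    · rw [TN w hwA]; exact hdis v hv w g hg.1.1


lemma init_ginv {Rf : V → ContactB0VPGRep G} {v : V} {S : Set V} (hvS : v ∈ S)
    (hcl : ∀ a ∈ S, ∀ b ∈ S, a ≠ b → G.Adj a b) {s : V → ℤ} (hs : ∀ x, s x = 1 ∨ s x = -1)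
    (sinj : ∀ x ∈ S, ∀ y ∈ S, x ≠ v → y ≠ v → s x = s y → x = y)
    {e : V → ℤ × ℤ} (he : ∀ x ∈ S, IE (e x) ((Rf x).seg x) ∧ ∀ z, z ∉ S → e x ∉ (Rf x).seg z) :
    ∃ T f g, GInv Rf v S T f g := by
  classical
  set T : V → Set (ℤ × ℤ) := fun x =>
    if x = v then {(0,0), (0,0) + (1,0), (0,0) - (1,0)} else {(0,0), (0,0) + (0, s x)} with hT
  have Tv : T v = {(0,0), (1,0), (-1,0)} := by simp [hT]
  have Tx : ∀ x, x ≠ v → T x = {(0,0), (0, s x)} := fun x hx => by simp [hT, hx]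
  have hdx : ∀ x, Dir (0, s x) := fun x => by rcases hs x with h | h <;> simp [Dir, h]
  have h0 : ∀ x, (0,0) ∈ T x := by
    intro x
    by_cases h : x = v
    · subst h; simp [Tv]
    · simp [Tx x h]
  have IEv1 : IE (1,0) (T v) := by
    rw [Tv]
    refine ⟨by simp, ?_⟩
    rintro d (rfl | rfl | rfl | rfl) <;> simp
  have IEv2 : IE (-1,0) (T v) := by
    rw [Tv]
    refine ⟨by simp, ?_⟩
    rintro d (rfl | rfl | rfl | rfl) <;> simp
  have IEx0 : ∀ x, x ≠ v → IE (0,0) (T x) := by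
    intro x hx
    rw [Tx x hx]
    refine ⟨by simp, ?_⟩
    rcases hs x with h | h <;> rw [h] <;> rintro d (rfl | rfl | rfl | rfl) <;> simp
  have IEx1 : ∀ x, x ≠ v → IE (0,s x) (T x) := by
    intro x hx
    rw [Tx x hx]
    refine ⟨by simp, ?_⟩
    rcases hs x with h | h <;> rw [h] <;> rintro d (rfl | rfl | rfl | rfl) <;> simp
  have hint : ∀ a ∈ S, ∀ b ∈ S, a ≠ b → ∀ q, q ∈ T a → q ∈ T b → q = (0,0) := by
    intro a ha b hb hab q qa qb
    have hsa : s a ≠ 0 := by rcases hs a with h | h <;> omega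
    have hsb : s b ≠ 0 := by rcases hs b with h | h <;> omega
    by_cases hav : a = v
    · have hbv : b ≠ v := fun k => hab (hav.trans k.symm)
      rw [hav, Tv] at qa
      rw [Tx b hbv] at qb
      rcases qa with rfl | rfl | rfl <;> simp at qb ⊢
    · rw [Tx a hav] at qa
      by_cases hbv : b = v
      · rw [hbv, Tv] at qb
        rcases qb with rfl | rfl | rfl <;> simp at qa ⊢
      · rw [Tx b hbv] at qb
        have := sinj a ha b hb hav hbv
        rcases qa with rfl | rfl
        · rfl
        · rcases qb with h | h
          · exact h
          · simp at h
            exact absurd (this h) hab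
  set f : V → ℤ × ℤ → ℤ × ℤ := fun x _ => if x = v then (1,0) else (0, s x) with hf
  have f0 : ∀ x q, f x q ≠ (0,0) := by
    intro x q
    by_cases h : x = v
    · simp [hf, h]
    · rcases hs x with h' | h' <;> simp [hf, h, h']
  have fIE : ∀ x q, IE (f x q) (T x) := by
    intro x q
    by_cases h : x = v
    · rw [h]; simpa [hf] using IEv1
    · simpa [hf, h] using IEx1 x h
  refine ⟨T, f, (-1,0), ⟨?_, ?_⟩, hvS, ?_, ?_, ?_, ?_, ?_⟩
  · intro a _
    by_cases h : a = v
    · simp only [hT, h, if_true]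
      exact seg_three _ (by simp [Dir])
    · simp only [hT, h, if_false]
      exact seg_two _ (hdx a)
  · intro a ha b hb hab
    refine ⟨⟨fun _ => ⟨(0,0), h0 a, h0 b⟩, fun _ => hcl a ha b hb hab⟩, ?_, ?_⟩
    · rintro x ⟨x1, x2⟩ y ⟨y1, y2⟩
      rw [hint a ha b hb hab x x1 x2, hint a ha b hb hab y y1 y2]
    · intro q qa qb
      rw [hint a ha b hb hab q qa qb]
      by_cases hav : a = v
      · exact Or.inr (IEx0 b fun k => hab (hav.trans k.symm))
      · exact Or.inl (IEx0 a hav)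
  · intro y hy z hz hyz
    obtain ⟨r, hr, hrz⟩ := ((Rf y).adj_iff y z hyz.ne).1 hyz
    refine ⟨⟨r, hr, e y, (he y hy).1.1, ?_⟩, ⟨_, (fIE y 0).1, _, h0 y, f0 y 0⟩⟩
    rintro rfl
    exact (he y hy).2 z hz hrz
  · intro y hy q _
    refine ⟨fIE y q, fun b hb hby hq => ?_⟩
    exact f0 y q (hint b hb y hy hby _ hq (fIE y q).1)
  · rintro y hy q ⟨hq, z, hz, hqz⟩ q' ⟨hq', z', hz', hqz'⟩ _
    refine two_ends ((Rf y).isSeg y) (he y hy).1 hq hq' ?_ ?_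
    · rintro rfl
      exact (he y hy).2 z hz hqz
    · rintro rfl
      exact (he y hy).2 z' hz' hqz'
  · refine ⟨IEv2, fun b hb hbv hq => ?_⟩
    have := hint b hb v hvS hbv _ hq IEv2.1
    simp at this
  · intro q _
    simp [hf]

lemma main [Finite V] (hch : Chordal G) (R : ContactB0VPGRep G) {v : V} {p : ℤ × ℤ}
    (hp : IsEndpointOf p (R.seg v))
    (hA : ¬ ∃ K : Finset V, v ∈ K ∧ K.card = 4 ∧ G.IsClique (K : Set V) ∧ ∀ w ∈ K, p ∈ R.seg w)
    (hB : ¬ ∃ w : V, w ≠ v ∧ InternalVertex G w ∧ p ∈ R.seg w ∧ ¬ IsEndpointOf p (R.seg w)) :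
    ¬ InternalVertex G v := by
  classical
  have hp' : IE p (R.seg v) := (endpoint_iff (R.isSeg v) p).1 hp
  set S : Set V := {z | p ∈ R.seg z} with hS
  have hvS : v ∈ S := hp'.1
  have hcl : ∀ a ∈ S, ∀ b ∈ S, a ≠ b → G.Adj a b := fun a ha b hb hab =>
    (R.adj_iff a b hab).2 ⟨p, ha, hb⟩
  have hs : ∃ s : V → ℤ, (∀ x, s x = 1 ∨ s x = -1) ∧
      ∀ x ∈ S, ∀ y ∈ S, x ≠ v → y ≠ v → s x = s y → x = y := by
    by_cases h : ∃ a ∈ S, a ≠ v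
    · obtain ⟨a, ha, hav⟩ := h
      refine ⟨fun x => if x = a then 1 else -1, fun x => by by_cases h : x = a <;> simp [h], ?_⟩
      intro x hx y hy hxv hyv hxy
      by_contra hne
      beta_reduce at hxy
      have hxa : x ≠ a := by
        rintro rfl
        rw [if_pos rfl, if_neg (Ne.symm hne)] at hxy
        omega
      have hya : y ≠ a := by
        rintro rfl
        rw [if_pos rfl, if_neg hne] at hxy
        omega
      have hall : ∀ w ∈ ({v, a, x, y} : Finset V), w ∈ S := by
        intro w hw
        simp only [Finset.mem_insert, Finset.mem_singleton] at hw
        rcases hw with rfl | rfl | rfl | rfl <;> assumption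
      refine hA ⟨{v, a, x, y}, by simp, ?_, ?_, hall⟩
      · rw [Finset.card_insert_of_notMem, Finset.card_insert_of_notMem, Finset.card_pair hne]
        · simp [hxa.symm, hya.symm]
        · simp [hav.symm, hxv.symm, hyv.symm]
      · intro b hb c hc hbc
        exact hcl b (hall b hb) c (hall c hc) hbc
    · push Not at h
      exact ⟨fun _ => 1, by simp, fun x hx y hy hxv => absurd (h x hx) hxv⟩
  obtain ⟨s, hs, sinj⟩ := hs
  have hex : ∀ x, ∃ (R' : ContactB0VPGRep G) (e : ℤ × ℤ), x ∈ S →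
      IE e (R'.seg x) ∧ ∀ z, z ∉ S → e ∉ R'.seg z := by
    intro x
    by_cases hx : x ∈ S
    swap
    · exact ⟨R, p, fun h => absurd h hx⟩
    by_cases hpx : IsEndpointOf p (R.seg x)
    · exact ⟨R, p, fun _ => ⟨(endpoint_iff (R.isSeg x) p).1 hpx, fun z hz => hz⟩⟩
    · have hxv : x ≠ v := by rintro rfl; exact hpx hp
      have hni : ¬ InternalVertex G x := fun k => hB ⟨x, hxv, k, hx, hpx⟩
      unfold InternalVertex at hni
      push Not at hni
      obtain ⟨R', e, he, hfree⟩ := hni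
      exact ⟨R', e, fun _ => ⟨(endpoint_iff (R'.isSeg x) e).1 he,
        fun z hz => hfree z (fun k => hz (k ▸ hx))⟩⟩
  choose Rx e he using hex
  have huniq : ∀ x ∈ S, ∀ y ∈ S, (HG G S).Reachable x y → x = y := fun x hx y hy h =>
    acyc' hch R hx hy h
  set Rf : V → ContactB0VPGRep G := fun z =>
    if h : ∃ x ∈ S, (HG G S).Reachable x z then Rx h.choose else R with hRf
  have key : ∀ x ∈ S, ∀ z, (HG G S).Reachable x z → Rf z = Rx x := by
    intro x hx z hz
    have h : ∃ x ∈ S, (HG G S).Reachable x z := ⟨x, hx, hz⟩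
    have : h.choose = x := huniq _ h.choose_spec.1 _ hx (h.choose_spec.2.trans hz.symm)
    simp only [hRf]
    rw [dif_pos h, this]
  have hcompat : ∀ a b, (HG G S).Adj a b → Rf a = Rf b := by
    intro a b hab
    by_cases h : ∃ x ∈ S, (HG G S).Reachable x a
    · obtain ⟨x, hx, hxa⟩ := h
      rw [key x hx a hxa, key x hx b (hxa.trans hab.reachable)]
    · have h' : ¬ ∃ x ∈ S, (HG G S).Reachable x b := by
        rintro ⟨x, hx, hxb⟩
        exact h ⟨x, hx, hxb.trans hab.symm.reachable⟩
      simp only [hRf]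
      rw [dif_neg h, dif_neg h']
  have hRS : ∀ x ∈ S, Rf x = Rx x := fun x hx => key x hx x (Reachable.refl x)
  obtain ⟨T, f, g, hG⟩ := init_ginv (Rf := Rf) (e := e) hvS hcl hs sinj
    (fun x hx => by rw [hRS x hx]; exact he x hx)
  have hAI : AInv G S S := by
    refine ⟨subset_rfl, ?_, ?_⟩
    · intro z hz a ha b hb haz hbz
      have h1 : (HG G S).Adj a z := ⟨haz, fun k => hz k.2⟩
      have h2 : (HG G S).Adj b z := ⟨hbz, fun k => hz k.2⟩
      exact huniq a ha b hb (h1.reachable.trans h2.symm.reachable)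
    · intro a ha b hb
      by_cases hab : a = b
      · rw [hab]
      · have : (KA G S).Adj a b := ⟨hcl a ha b hb hab, ha, hb⟩
        exact this.reachable
  obtain ⟨A, T', f', g', hA', hG', hcl'⟩ := grow hch hcompat _ S T f g hAI hG rfl
  exact finish R hG'.prep hG'.vA hG'.gfree hcl'

end CB

/-- In a chordal contact B₀-VPG graph, `v` is internal iff in every
representation, each endpoint of `P_v` either is the common point of a clique of size 4
containing `v`, or lies in the segment of an internal vertex `w ≠ v` without being an
endpoint of that segment. -/
theorem stmt_5 {V : Type*} [Fintype V] (G : SimpleGraph V) (hch : Chordal G)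
    (hc : ContactB0VPG G) (v : V) :
    InternalVertex G v ↔
      ∀ (R : ContactB0VPGRep G) (p : ℤ × ℤ), IsEndpointOf p (R.seg v) →
        ((∃ K : Finset V, v ∈ K ∧ K.card = 4 ∧ G.IsClique (K : Set V) ∧
            ∀ w ∈ K, p ∈ R.seg w) ∨
         (∃ w : V, w ≠ v ∧ InternalVertex G w ∧ p ∈ R.seg w ∧
            ¬ IsEndpointOf p (R.seg w))) := by
  classical
  constructor
  · intro hv R p hp
    by_contra hcon
    rw [not_or] at hcon
    exact CB.main hch R hp hcon.1 hcon.2 hv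
  · rintro h R ⟨p, hp, hfree⟩
    rcases h R p hp with ⟨K, hvK, hK, -, hall⟩ | ⟨w, hw, -, hpw, -⟩
    · obtain ⟨w, hw, hne⟩ := Finset.exists_mem_ne (by omega : 1 < K.card) v
      exact hfree w hne (hall w hw)
    · exact hfree w hw hpw
end
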